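/- arXiv:2511.02790 — 2 statements merged into one kernel-verified Lean document; each statement's English description precedes it below -/
import Mathlib

section
/- For every integer g ≥ 3 there exists a natural number N (depending on g) such that every natural number n ≥ N can be written as n = a + b + c, where a, b, c are base-g Niven numbers. -/
set_option autoImplicit false

/-- A base-`g` Niven number: a positive integer divisible by its base-`g` digit sum. -/
def IsNiven (g n : ℕ) : Prop := 0 < n ∧ (Nat.digits g n).sum ∣ n

section DigitSums

variable {g : ℕ}

lemma digits_sum_add_mul (hg : 2 ≤ g) (e x : ℕ) (he : e < g) :
    (Nat.digits g (e + g * x)).sum = e + (Nat.digits g x).sum := by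
  by_cases h : e = 0 ∧ x = 0
  · obtain ⟨rfl, rfl⟩ := h
    simp
  · rw [Nat.digits_add g (by omega) e x he (by tauto), List.sum_cons]

lemma digits_sum_mul_pow_add (hg : 2 ≤ g) (x : ℕ) :
    ∀ m w : ℕ, w < g ^ m →
      (Nat.digits g (x * g ^ m + w)).sum = (Nat.digits g x).sum + (Nat.digits g w).sum := by
  intro m
  induction m with
  | zero =>
    intro w hw
    obtain rfl : w = 0 := by simpa using hw
    simp
  | succ m ih =>
    intro w hw
    have hpos : 0 < g := by omega
    have hdiv : w / g < g ^ m := Nat.div_lt_of_lt_mul (by rwa [← pow_succ'])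
    have hw' := Nat.mod_add_div w g
    have hlt := Nat.mod_lt w hpos
    have hsplit : x * g ^ (m + 1) + w = w % g + g * (x * g ^ m + w / g) := by
      conv_lhs => rw [← hw']
      ring
    rw [hsplit, digits_sum_add_mul hg _ _ hlt, ih _ hdiv]
    conv_rhs => rw [← hw', digits_sum_add_mul hg _ _ hlt]
    ring

lemma digits_sum_pow_mul (hg : 2 ≤ g) (x m : ℕ) :
    (Nat.digits g (g ^ m * x)).sum = (Nat.digits g x).sum := by
  have h := digits_sum_mul_pow_add hg x m 0 (by positivity)
  simpa [mul_comm] using h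

lemma digits_sum_add_digits_sum_complement (hg : 2 ≤ g) :
    ∀ m x y : ℕ, x + y + 1 = g ^ m →
      (Nat.digits g x).sum + (Nat.digits g y).sum = (g - 1) * m := by
  intro m
  induction m with
  | zero =>
    intro x y h
    obtain ⟨rfl, rfl⟩ : x = 0 ∧ y = 0 := by simp at h; omega
    simp
  | succ m ih =>
    intro x y h
    have hpos : 0 < g := by omega
    have hx := Nat.mod_add_div x g
    have hy := Nat.mod_add_div y g
    have hxlt := Nat.mod_lt x hpos
    have hylt := Nat.mod_lt y hpos
    set e := x % g
    set f := y % g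
    set X := x / g
    set Y := y / g
    rw [pow_succ', ← hx, ← hy] at h
    have hef : e + f + 1 = g := by
      have hdvd : g ∣ e + f + 1 := by
        have h1 : g ∣ g * (X + Y) + (e + f + 1) := ⟨g ^ m, by rw [← h]; ring⟩
        exact (Nat.dvd_add_right (dvd_mul_right _ _)).mp h1
      obtain ⟨q, hq⟩ := hdvd
      have hq1 : 0 < q := by
        rcases Nat.eq_zero_or_pos q with rfl | h0
        · simp at hq
        · exact h0
      have hq2 : q < 2 := by
        by_contra hcon
        have : g * 2 ≤ g * q := Nat.mul_le_mul_left _ (by omega)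
        omega
      obtain rfl : q = 1 := by omega
      omega
    have hXY : X + Y + 1 = g ^ m := by
      apply Nat.eq_of_mul_eq_mul_left hpos
      rw [← h, Nat.mul_add, Nat.mul_add]
      omega
    have hsum := ih X Y hXY
    rw [← hx, ← hy, digits_sum_add_mul hg _ _ hxlt, digits_sum_add_mul hg _ _ hylt, mul_add]
    omega

lemma digits_sum_eq_pred_add_one (hg : 2 ≤ g) (y : ℕ) (hy : ¬ g ∣ y) :
    (Nat.digits g y).sum = (Nat.digits g (y - 1)).sum + 1 := by
  have hlt := Nat.mod_lt y (show 0 < g by omega)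
  have hsplit := Nat.mod_add_div y g
  have hne : y % g ≠ 0 := fun h => hy (Nat.dvd_of_mod_eq_zero h)
  have hpred : y - 1 = (y % g - 1) + g * (y / g) := by omega
  rw [hpred, digits_sum_add_mul hg _ _ (by omega)]
  conv_lhs => rw [← hsplit, digits_sum_add_mul hg _ _ hlt]
  omega

lemma digits_sum_mul_pow_sub_one (hg : 2 ≤ g) (j z : ℕ) (hz : 0 < z) (hzj : z ≤ g ^ j) :
    (Nat.digits g (z * (g ^ j - 1))).sum = (g - 1) * j := by
  have hsplit : z * (g ^ j - 1) = (z - 1) * g ^ j + (g ^ j - z) := by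
    obtain ⟨w, rfl⟩ : ∃ w, z = w + 1 := ⟨z - 1, by omega⟩
    obtain ⟨v, hv⟩ : ∃ v, g ^ j = w + 1 + v := ⟨g ^ j - (w + 1), by omega⟩
    rw [hv]
    have h1 : w + 1 + v - 1 = w + v := by omega
    have h2 : w + 1 + v - (w + 1) = v := by omega
    rw [h1, h2, Nat.add_sub_cancel]
    ring
  rw [hsplit, digits_sum_mul_pow_add hg _ _ _ (by omega)]
  exact digits_sum_add_digits_sum_complement hg j _ _ (by omega)

lemma digits_sum_le_of_lt_pow (hg : 2 ≤ g) (m x : ℕ) (hx : x < g ^ m) :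
    (Nat.digits g x).sum ≤ (g - 1) * m := by
  have := digits_sum_add_digits_sum_complement hg m x (g ^ m - 1 - x) (by omega)
  omega

lemma modEq_digits_sum_pred (hg : 3 ≤ g) (x : ℕ) :
    x ≡ (Nat.digits g x).sum [MOD g - 1] := by
  refine Nat.modEq_digits_sum (g - 1) g ?_ x
  rw [Nat.mod_eq_sub_mod (by omega), Nat.sub_sub_self (by omega)]
  exact Nat.mod_eq_of_lt (by omega)

/-- For `z ≤ g ^ j` a positive multiple of `j`, the number `z * (g ^ j - 1)` has digit sum
`(g - 1) * j` and hence is Niven, as are its products with powers of `g`. -/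
lemma isNiven_pow_mul (hg : 2 ≤ g) (s j z : ℕ) (hj : j ∣ z) (hz : 0 < z) (hzj : z ≤ g ^ j)
    (hj0 : 0 < j) : IsNiven g (g ^ s * (z * (g ^ j - 1))) := by
  have hone : 1 < g ^ j := Nat.one_lt_pow hj0.ne' (by omega)
  refine ⟨Nat.mul_pos (by positivity) (Nat.mul_pos hz (by omega)), ?_⟩
  rw [digits_sum_pow_mul hg, digits_sum_mul_pow_sub_one hg j z hz hzj, mul_comm (g - 1)]
  exact Dvd.dvd.mul_left (mul_dvd_mul hj (Nat.sub_one_dvd_pow_sub_one g j)) _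

lemma digits_sum_mul_pow_sub_shift (hg : 2 ≤ g) (H s M y j : ℕ) (hH : 0 < H) (hgy : ¬ g ∣ y)
    (hyM : y < g ^ M) (hy : (Nat.digits g y).sum = (g - 1) * j) (hjM : j ≤ M) :
    (Nat.digits g (H * g ^ (s + M) - g ^ s * y)).sum =
      (Nat.digits g (H - 1)).sum + 1 + (g - 1) * (M - j) := by
  have hy0 : 0 < y := Nat.pos_of_ne_zero (by rintro rfl; simp at hgy)
  have hsplit : H * g ^ (s + M) - g ^ s * y = g ^ s * ((H - 1) * g ^ M + (g ^ M - y)) := by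
    obtain ⟨G, rfl⟩ : ∃ G, H = G + 1 := ⟨H - 1, by omega⟩
    obtain ⟨v, hv⟩ : ∃ v, g ^ M = y + v := ⟨g ^ M - y, by omega⟩
    rw [pow_add, hv, Nat.add_sub_cancel, Nat.add_sub_cancel_left]
    apply Nat.sub_eq_of_eq_add
    ring
  rw [hsplit, digits_sum_pow_mul hg, digits_sum_mul_pow_add hg _ _ _ (by omega)]
  have h1 := digits_sum_add_digits_sum_complement hg M (y - 1) (g ^ M - y) (by omega)
  have h2 := digits_sum_eq_pred_add_one hg y hgy
  have h3 : (g - 1) * M = (g - 1) * (M - j) + (g - 1) * j := by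
    rw [← mul_add, Nat.sub_add_cancel hjM]
  omega

end DigitSums

lemma exists_modEq_mem_interval (q X t : ℕ) (hq : 0 < q) :
    ∃ r, X ≤ r ∧ r < X + q ∧ r ≡ t [MOD q] := by
  obtain ⟨p, rfl⟩ : ∃ p, q = p + 1 := ⟨q - 1, by omega⟩
  refine ⟨X + (t + X * p) % (p + 1), by omega, ?_, ?_⟩
  · have := Nat.mod_lt (t + X * p) hq
    omega
  · calc X + (t + X * p) % (p + 1) ≡ X + (t + X * p) [MOD p + 1] :=
          (Nat.mod_modEq _ _).add_left X
      _ = t + (p + 1) * X := by ring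
      _ ≡ t [MOD p + 1] := by simp [Nat.ModEq]

lemma exists_modEq_modEq_mem_interval (p q X s t : ℕ) (hp : 0 < p) (hq : 0 < q)
    (hpq : p.Coprime q) :
    ∃ r, X ≤ r ∧ r < X + p * q ∧ r ≡ s [MOD p] ∧ r ≡ t [MOD q] := by
  obtain ⟨u, hup, huq⟩ := Nat.chineseRemainder hpq s t
  obtain ⟨r, h1, h2, h3⟩ := exists_modEq_mem_interval (p * q) X u (Nat.mul_pos hp hq)
  exact ⟨r, h1, h2, (h3.of_mul_right q).trans hup, (h3.of_mul_left p).trans huq⟩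

/-- A multiple of a high power of `g` is a sum of two Niven numbers: the second is
`g ^ s * (z * (g ^ J - 1))`, the digit sum `r * g ^ k` of the first does not depend on `z`, and `z`
is chosen to make the first divisible by `r`. -/
lemma exists_isNiven_add_isNiven {g H m k J r M : ℕ} (hg : 3 ≤ g) (hH : 0 < H) (hM : M + k ≤ m)
    (hJM : 2 * J ≤ M) (hrg : r.Coprime g) (hr : 0 < r) (hJr : J ≡ 1 [MOD r])
    (hJg : J ≡ 1 [MOD g]) (hpow : g ^ J ≡ g [MOD r]) (hJ : J * (r * g) ≤ g ^ J)
    (hd : r * g ^ k = (Nat.digits g (H - 1)).sum + 1 + (g - 1) * (M - J)) :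
    ∃ a b, IsNiven g a ∧ IsNiven g b ∧ H * g ^ m = a + b := by
  have hg1 : 1 < g := by omega
  have hJ0 : 0 < J := by
    refine Nat.pos_of_ne_zero ?_
    rintro rfl
    simp [Nat.ModEq, Nat.mod_eq_of_lt hg1] at hJg
  have hgmod : g ≡ 1 [MOD g - 1] := by
    exact ((Nat.modEq_iff_dvd' hg1.le).mpr dvd_rfl).symm
  have hHr : H ≡ r [MOD g - 1] := by
    calc H = (H - 1) + 1 := by omega
      _ ≡ (Nat.digits g (H - 1)).sum + 1 [MOD g - 1] :=
        (modEq_digits_sum_pred hg _).add_right 1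
      _ ≡ (Nat.digits g (H - 1)).sum + 1 + (g - 1) * (M - J) [MOD g - 1] := by simp [Nat.ModEq]
      _ = r * g ^ k := hd.symm
      _ ≡ r * 1 ^ k [MOD g - 1] := (hgmod.pow k).mul_left r
      _ = r := by simp
  obtain ⟨t, ht⟩ : g - 1 ∣ H + r * (g - 2) := by
    rw [← Nat.modEq_zero_iff_dvd]
    calc H + r * (g - 2) ≡ r + r * (g - 2) [MOD g - 1] := hHr.add_right _
      _ = r * (1 + (g - 2)) := by ring
      _ = (g - 1) * r := by rw [show 1 + (g - 2) = g - 1 by omega, mul_comm]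
      _ ≡ 0 [MOD g - 1] := by simp [Nat.ModEq]
  have htr : t * (g - 1) ≡ H [MOD r] := by
    rw [mul_comm, ← ht]
    simp [Nat.ModEq]
  obtain ⟨w, hw1, hwlt, hwr, hwg⟩ :=
    exists_modEq_modEq_mem_interval r g 1 (t * g ^ M) 1 hr (by omega) hrg
  obtain ⟨s, rfl⟩ : ∃ s, m = s + M := ⟨m - M, by omega⟩
  have hz0 : 0 < J * w := Nat.mul_pos hJ0 hw1
  have hzJ : J * w ≤ g ^ J := le_trans (Nat.mul_le_mul_left J (by omega)) hJ
  have hpowJ : 1 < g ^ J := Nat.one_lt_pow hJ0.ne' hg1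
  set y := J * w * (g ^ J - 1) with hy
  have hyM : y < g ^ M := by
    calc y < g ^ J * g ^ J := by
          apply lt_of_le_of_lt (Nat.mul_le_mul_right _ hzJ)
          exact Nat.mul_lt_mul_of_pos_left (by omega) (by omega)
      _ = g ^ (2 * J) := by rw [two_mul, pow_add]
      _ ≤ g ^ M := Nat.pow_le_pow_right (by omega) hJM
  have hpred : g ^ J - 1 ≡ g - 1 [MOD r] := by
    apply Nat.ModEq.add_right_cancel' 1
    rwa [Nat.sub_add_cancel hpowJ.le, Nat.sub_add_cancel hg1.le]
  have hyr : y ≡ H * g ^ M [MOD r] := by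
    calc y ≡ 1 * (t * g ^ M) * (g - 1) [MOD r] := (hJr.mul hwr).mul hpred
      _ = t * (g - 1) * g ^ M := by ring
      _ ≡ H * g ^ M [MOD r] := htr.mul_right _
  have hgy : ¬ g ∣ y := by
    intro h
    have h1 : y + J * w = J * w * g ^ J := by
      rw [hy, ← Nat.mul_succ]
      congr 1
      omega
    have h2 : g ∣ y + J * w := h1 ▸ Dvd.dvd.mul_left (dvd_pow_self g hJ0.ne') _
    have h3 : g ∣ J * w := (Nat.dvd_add_right h).mp h2
    have h4 : g ∣ 1 := ((hJg.mul hwg).dvd_iff dvd_rfl).mp h3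
    have := Nat.le_of_dvd one_pos h4
    omega
  have hlt : g ^ s * y < H * g ^ (s + M) := by
    calc g ^ s * y < g ^ s * g ^ M := Nat.mul_lt_mul_of_pos_left hyM (by positivity)
      _ = 1 * g ^ (s + M) := by rw [one_mul, pow_add]
      _ ≤ H * g ^ (s + M) := Nat.mul_le_mul_right _ hH
  refine ⟨H * g ^ (s + M) - g ^ s * y, g ^ s * y, ⟨by omega, ?_⟩,
    isNiven_pow_mul (by omega) s J (J * w) (dvd_mul_right _ _) hz0 hzJ hJ0, by omega⟩
  rw [digits_sum_mul_pow_sub_shift (by omega) H s M y J hH hgy hyM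
    (digits_sum_mul_pow_sub_one (by omega) J _ hz0 hzJ) (by omega), ← hd]
  refine (hrg.pow_right k).mul_dvd_of_dvd_of_dvd ?_ ?_
  · rw [← Nat.modEq_iff_dvd' hlt.le]
    calc g ^ s * y ≡ g ^ s * (H * g ^ M) [MOD r] := hyr.mul_left _
      _ = H * g ^ (s + M) := by rw [pow_add]; ring
  · exact Nat.dvd_sub (Dvd.dvd.mul_left (pow_dvd_pow g (by omega)) H)
      (Dvd.dvd.mul_right (pow_dvd_pow g (by omega)) y)

lemma pow_factorial_add_one_modEq {g r R : ℕ} (hr : 0 < r) (hrR : r ≤ R) (hrg : r.Coprime g) :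
    g ^ (R.factorial + 1) ≡ g [MOD r] := by
  obtain ⟨q, hq⟩ : r.totient ∣ R.factorial :=
    Nat.dvd_factorial (Nat.totient_pos.mpr hr) ((Nat.totient_le r).trans hrR)
  rw [hq, pow_succ, pow_mul]
  simpa using ((Nat.ModEq.pow_totient hrg.symm).pow q).mul_right g

lemma factorial_add_one_modEq {r R : ℕ} (hr : 0 < r) (hrR : r ≤ R) :
    R.factorial + 1 ≡ 1 [MOD r] := by
  simpa using ((Nat.modEq_zero_iff_dvd.mpr (Nat.dvd_factorial hr hrR)).add_right 1)

lemma exists_digit_sum_target {g h k J : ℕ} (hg : 3 ≤ g) (hJ : 2 * J ≤ g ^ k)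
    (hh : h ≤ (g - 1) * g ^ (k + 4)) :
    ∃ r M, 0 < r ∧ r ≤ g ^ 5 ∧ r.Coprime g ∧ 2 * J ≤ M ∧ M + k ≤ 2 * g ^ (k + 1) ∧
      r * g ^ k = h + 1 + (g - 1) * (M - J) := by
  obtain ⟨f, rfl⟩ : ∃ f, g = f + 1 := ⟨g - 1, by omega⟩
  rw [Nat.add_sub_cancel] at *
  set G := (f + 1) ^ k with hG
  have hGpos : 0 < G := by positivity
  have hkG : k < G := Nat.lt_pow_self (by omega)
  have hdivlt := Nat.lt_div_mul_add hGpos (a := h + f * J)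
  have hdivle := Nat.div_mul_le_self (h + f * J) G
  set X := (h + f * J) / G
  obtain ⟨r, hXr, hrX, hr1, hrh⟩ := exists_modEq_modEq_mem_interval (f + 1) f (X + 1) 1 (h + 1)
    (by omega) (by omega) (by simp)
  have hlow : h + 1 + f * J ≤ r * G := by
    have : (X + 1) * G ≤ r * G := Nat.mul_le_mul_right _ hXr
    rw [add_mul, one_mul] at this
    omega
  have hmod : h + 1 ≡ r * G [MOD f] := by
    calc h + 1 ≡ r * 1 ^ k [MOD f] := by simpa using hrh.symm
      _ ≡ r * G [MOD f] := (Nat.ModEq.pow k (by simp [Nat.ModEq])).mul_left r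
  obtain ⟨q, hq⟩ := (Nat.modEq_iff_dvd' (by omega)).mp hmod
  have hd : r * G = h + 1 + f * q := by omega
  have hJq : J ≤ q := Nat.le_of_mul_le_mul_left (by omega : f * J ≤ f * q) (by omega)
  have hupper : f * q < f * (J + G + (f + 1) * G) := by
    have h1 : r * G ≤ (X + (f + 1) * f) * G := Nat.mul_le_mul_right _ (by omega)
    have h2 : G * 1 ≤ G * f := Nat.mul_le_mul_left _ (by omega)
    nlinarith
  have hqlt := Nat.lt_of_mul_lt_mul_left hupper
  have hG3 : 3 * G ≤ (f + 1) * G := Nat.mul_le_mul_right _ hg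
  have hM : q + J + k ≤ 2 * ((f + 1) * G) := by omega
  have hr0 : 0 < r := (Nat.succ_pos X).trans_le hXr
  refine ⟨r, q + J, hr0, ?_, ?_, by omega, by rwa [pow_succ'], by rwa [Nat.add_sub_cancel]⟩
  · refine Nat.le_of_mul_le_mul_right (c := G) ?_ hGpos
    have h1 : f * q ≤ f * (2 * ((f + 1) * G)) := Nat.mul_le_mul_left _ (by omega)
    have h2 : (f + 1) ^ (k + 4) = (f + 1) ^ 4 * G := by rw [pow_add, mul_comm]
    rw [h2] at hh
    have h3 : 3 * 3 * ((f + 1) * (f + 1) * G) ≤ (f + 1) * (f + 1) * ((f + 1) * (f + 1) * G) :=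
      Nat.mul_le_mul_right _ (Nat.mul_le_mul hg hg)
    have h4 : 0 < (f + 1) * (f + 1) * G := by positivity
    nlinarith
  · exact Nat.coprime_of_mul_modEq_one 1 (by simpa using hr1)

lemma exists_isNiven_add_eq_mul_pow {g n L k : ℕ} (hg : 3 ≤ g) (hkL : g ^ (k + 3) ≤ L)
    (hn : g ^ L ≤ n) :
    ∃ c H, IsNiven g c ∧ 0 < H ∧ n = c + H * g ^ (2 * g ^ (k + 1)) := by
  set e := g ^ (k + 1) with he
  have he3 : 3 ≤ e := hg.trans (Nat.le_self_pow (by omega) g)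
  have hLe : 9 * e ≤ L := by
    calc 9 * e ≤ g ^ 2 * e := Nat.mul_le_mul_right _ (by nlinarith)
      _ = g ^ (k + 3) := by rw [he]; ring
      _ ≤ L := hkL
  have hcop : (3 * e + 1).Coprime (g ^ (2 * e)) := by
    refine Nat.Coprime.pow_right _ ?_
    have : g ∣ 3 * e := Dvd.dvd.mul_left (dvd_pow_self g (by omega)) 3
    exact Nat.Coprime.coprime_dvd_right this (by simp)
  have hpos : 0 < g ^ (2 * e) := by positivity
  obtain ⟨u, hu1, hult, hu0, hun⟩ := exists_modEq_modEq_mem_interval (3 * e + 1) (g ^ (2 * e)) 1 0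
    (n * (g ^ (2 * e) - 1)) (by omega) hpos hcop
  have hupow : u ≤ g ^ (3 * e + 1) := by
    have h1 : e < g ^ e := Nat.lt_pow_self (by omega)
    calc u ≤ (3 * e + 1) * g ^ (2 * e) := by omega
      _ ≤ (g * g ^ e) * g ^ (2 * e) := Nat.mul_le_mul_right _ (by nlinarith)
      _ = g ^ (3 * e + 1) := by ring
  have hniven := isNiven_pow_mul (by omega) 0 (3 * e + 1) u (Nat.modEq_zero_iff_dvd.mp hu0) hu1
    hupow (by omega)
  rw [pow_zero, one_mul] at hniven
  have hK : 0 < g ^ (3 * e + 1) := by positivity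
  have hcn : u * (g ^ (3 * e + 1) - 1) < n := by
    calc u * (g ^ (3 * e + 1) - 1) < g ^ (3 * e + 1) * g ^ (3 * e + 1) :=
          lt_of_le_of_lt (Nat.mul_le_mul_right _ hupow)
            (Nat.mul_lt_mul_of_pos_left (by omega) hK)
      _ = g ^ (3 * e + 1 + (3 * e + 1)) := (pow_add _ _ _).symm
      _ ≤ g ^ L := Nat.pow_le_pow_right (by omega) (by omega)
      _ ≤ n := hn
  have hnu : g ^ (2 * e) ∣ n + u := by
    rw [← Nat.modEq_zero_iff_dvd]
    calc n + u ≡ n + n * (g ^ (2 * e) - 1) [MOD g ^ (2 * e)] := hun.add_left n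
      _ = g ^ (2 * e) * n := by
        rw [add_comm, ← Nat.mul_succ, mul_comm]
        congr 1
        omega
      _ ≡ 0 [MOD g ^ (2 * e)] := by simp [Nat.ModEq]
  have hsplit : n + u = u * g ^ (3 * e + 1) + (n - u * (g ^ (3 * e + 1) - 1)) := by
    have : u * g ^ (3 * e + 1) = u * (g ^ (3 * e + 1) - 1) + u := by
      rw [← Nat.mul_succ]
      congr 1
      omega
    omega
  have hdvd : g ^ (2 * e) ∣ n - u * (g ^ (3 * e + 1) - 1) := by
    rw [hsplit] at hnu
    exact (Nat.dvd_add_right (Dvd.dvd.mul_left (pow_dvd_pow g (by omega)) u)).mp hnu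
  obtain ⟨H, hH⟩ := hdvd
  refine ⟨_, H, hniven, ?_, by rw [mul_comm H, ← hH]; omega⟩
  refine Nat.pos_of_ne_zero ?_
  rintro rfl
  omega

lemma cube_le_three_pow (i : ℕ) (hi : 4 ≤ i) : i ^ 3 ≤ 3 ^ i := by
  induction i, hi using Nat.le_induction with
  | base => norm_num
  | succ i hi ih =>
    rw [pow_succ 3]
    nlinarith [mul_self_nonneg i]

theorem statement0 (g : ℕ) (hg : 3 ≤ g) :
    ∃ N : ℕ, ∀ n : ℕ, N ≤ n →
      ∃ a b c : ℕ, IsNiven g a ∧ IsNiven g b ∧ IsNiven g c ∧ n = a + b + c := by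
  set R := g ^ 5 with hR
  set J := R.factorial + 1 with hJ
  have hgR : g ≤ R := Nat.le_self_pow (by omega) g
  refine ⟨g ^ g ^ (2 * J + 3), fun n hn => ?_⟩
  have hg1 : 1 < g := by omega
  have hn0 : n ≠ 0 := (lt_of_lt_of_le (by positivity) hn).ne'
  set L := Nat.log g n with hL
  have hLlow : g ^ (2 * J + 3) ≤ L := Nat.le_log_of_pow_le hg1 hn
  have hL0 : L ≠ 0 := (lt_of_lt_of_le (by positivity) hLlow).ne'
  obtain ⟨k, hk⟩ : ∃ k, Nat.log g L = k + 3 :=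
    ⟨Nat.log g L - 3, by have := Nat.le_log_of_pow_le hg1 hLlow; omega⟩
  have hJk : 2 * J ≤ k := by
    have := Nat.le_log_of_pow_le hg1 hLlow
    omega
  have hkL : g ^ (k + 3) ≤ L := hk ▸ Nat.pow_log_le_self g hL0
  have hLk : L < g ^ (k + 4) := by
    have := Nat.lt_pow_succ_log_self hg1 L
    rwa [hk] at this
  obtain ⟨c, H, hc, hH, hnc⟩ :=
    exists_isNiven_add_eq_mul_pow hg hkL (Nat.pow_log_le_self g hn0)
  have hHn : H - 1 < g ^ (L + 1) := by
    have h1 : H * 1 ≤ H * g ^ (2 * g ^ (k + 1)) :=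
      Nat.mul_le_mul_left _ (Nat.one_le_pow _ _ (by omega))
    have h2 : n < g ^ (L + 1) := Nat.lt_pow_succ_log_self hg1 n
    omega
  have hh : (Nat.digits g (H - 1)).sum ≤ (g - 1) * g ^ (k + 4) :=
    (digits_sum_le_of_lt_pow (by omega) _ _ hHn).trans (Nat.mul_le_mul_left _ hLk)
  obtain ⟨r, M, hr, hrR, hrg, hJM, hM, hd⟩ :=
    exists_digit_sum_target hg (hJk.trans (Nat.lt_pow_self hg1).le) hh
  have hbound : J * (r * g) ≤ g ^ J := by
    have hR3 : 3 ≤ R := hg.trans hgR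
    have hRJ : R ≤ R.factorial := Nat.self_le_factorial R
    calc J * (r * g) ≤ J * (J * J) :=
          Nat.mul_le_mul_left _ (Nat.mul_le_mul (by omega) (by omega))
      _ = J ^ 3 := by ring
      _ ≤ 3 ^ J := cube_le_three_pow J (by omega)
      _ ≤ g ^ J := Nat.pow_le_pow_left hg J
  obtain ⟨a, b, ha, hb, hab⟩ := exists_isNiven_add_isNiven hg hH hM hJM hrg hr
    (factorial_add_one_modEq hr hrR) (factorial_add_one_modEq (by omega) hgR)
    (pow_factorial_add_one_modEq hr hrR hrg) hbound hd
  exact ⟨a, b, c, ha, hb, hc, by omega⟩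
end

section
/- Let g ≥ 3. There exist constants c = c(g) > 0 and K_0 = K_0(g) such that for all integers K ≥ K_0, all integers M with g^{K−1} < M ≤ g^K, and all integers k_1, k_2, k_3 satisfying |k_i − μ_K| ≤ C_g for i = 1,2,3 and k_1 + k_2 + k_3 ≡ M (mod g−1), the number r of triples (s_1, s_2, s_3) ∈ S_g(k_1) × S_g(k_2) × S_g(k_3) with s_1 + s_2 + s_3 = M satisfies |r − (g−1)M²/(2(2πσ²K)^{3/2})| ≤ c · ((g−1)M²/(2(2πσ²K)^{3/2})) · (log K)⁴ K^{−1/4}. -/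
set_option autoImplicit false

noncomputable section

/-- Base-`g` digit sum. -/
def digitSum (g n : ℕ) : ℕ := (Nat.digits g n).sum

/-- `S_g(k)`: naturals below `g^K` with base-`g` digit sum `k`. -/
def Sset (g K : ℕ) (k : ℤ) : Finset ℕ :=
  (Finset.range (g ^ K)).filter fun n => (digitSum g n : ℤ) = k

/-- The average digit sum `μ_K = (g-1)K/2`. -/
def muK (g K : ℕ) : ℝ := ((g : ℝ) - 1) * K / 2

/-- `C_g = g(g-1) ∏_{p ≤ 10g², p prime} p`. -/
def Cg (g : ℕ) : ℕ := g * (g - 1) * ∏ p ∈ (Finset.Iic (10 * g ^ 2)).filter Nat.Prime, p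

/-- Number of representations of `M` as `s₁+s₂+s₃` with `sᵢ ∈ S_g(kᵢ)`. -/
def rS (g K : ℕ) (k1 k2 k3 : ℤ) (M : ℕ) : ℕ :=
  ((Sset g K k1 ×ˢ Sset g K k2 ×ˢ Sset g K k3).filter
    fun p => p.1 + p.2.1 + p.2.2 = M).card

/-- The unimodular complex number `exp (i t)`. -/
def expI (t : ℝ) : ℂ := Complex.exp (Complex.I * t)

/-- The digit sum of the residue of `z` modulo `g ^ j`. -/
def residueDigitSum (g j : ℕ) (z : ℤ) : ℝ := digitSum g (z % (g : ℤ) ^ j).toNat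

/-- The transfer operator that sums over the lowest `j` base-`g` digits of `a + b + c = N`, with
phase `θ` on the three digit sums, the remaining digits being weighted by `f`. -/
def transferOp (g : ℕ) (θ : Fin 3 → ℝ) (j : ℕ) (f : ℤ → ℂ) (N : ℤ) : ℂ :=
  ∑ a ∈ Finset.range (g ^ j), ∑ b ∈ Finset.range (g ^ j),
    expI (θ 0 * digitSum g a + θ 1 * digitSum g b + θ 2 * residueDigitSum g j (N - a - b)) *
      f ((N - a - b) / (g : ℤ) ^ j)

lemma expI_add (s t : ℝ) : expI (s + t) = expI s * expI t := by
  simp [expI, mul_add, Complex.exp_add]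

@[simp] lemma expI_zero : expI 0 = 1 := by simp [expI]

@[simp] lemma norm_expI (t : ℝ) : ‖expI t‖ = 1 := by
  rw [expI, mul_comm]; exact Complex.norm_exp_ofReal_mul_I t

lemma norm_expI_sub_one_le (t : ℝ) : ‖expI t - 1‖ ≤ |t| :=
  Real.norm_exp_I_mul_ofReal_sub_one_le

lemma digitSum_add_mul {g : ℕ} (hg : 2 ≤ g) {d : ℕ} (hd : d < g) (m : ℕ) :
    digitSum g (d + g * m) = d + digitSum g m := by
  unfold digitSum
  by_cases h : d = 0 ∧ m = 0
  · simp [h.1, h.2]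
  · rw [Nat.digits_add g (by omega) d m hd (by omega)]
    simp

lemma digitSum_of_lt {g : ℕ} (hg : 2 ≤ g) {d : ℕ} (hd : d < g) : digitSum g d = d := by
  simpa [digitSum] using digitSum_add_mul hg hd 0

lemma digitSum_add_pow_mul {g : ℕ} (hg : 2 ≤ g) (j : ℕ) :
    ∀ {a : ℕ}, a < g ^ j → ∀ m, digitSum g (a + g ^ j * m) = digitSum g a + digitSum g m := by
  induction j with
  | zero =>
    intro a ha m
    have : a = 0 := by simpa using ha
    simp [this, digitSum]
  | succ j ih =>
    intro a ha m
    have h1 : a = a % g + g * (a / g) := (Nat.mod_add_div a g).symm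
    have hlt : a % g < g := Nat.mod_lt _ (by omega)
    have hq : a / g < g ^ j := by
      rw [Nat.div_lt_iff_lt_mul (by omega), ← pow_succ]; exact ha
    have h2 : a + g ^ (j + 1) * m = a % g + g * (a / g + g ^ j * m) := by
      conv_lhs => rw [h1]
      ring
    rw [h2, digitSum_add_mul hg hlt, ih hq m]
    conv_rhs => rw [h1, digitSum_add_mul hg hlt]
    ring

lemma digitSum_le {g : ℕ} (hg : 2 ≤ g) (j : ℕ) : ∀ {a : ℕ}, a < g ^ j → digitSum g a ≤ j * g := by
  induction j with
  | zero =>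
    intro a ha
    have : a = 0 := by simpa using ha
    simp [this, digitSum]
  | succ j ih =>
    intro a ha
    have hlt : a % g < g := Nat.mod_lt _ (by omega)
    have hq : a / g < g ^ j := by
      rw [Nat.div_lt_iff_lt_mul (by omega), ← pow_succ]; exact ha
    rw [← Nat.mod_add_div a g, digitSum_add_mul hg hlt]
    have := ih hq
    nlinarith

lemma toNat_emod_lt {g : ℕ} (hg : 2 ≤ g) (j : ℕ) (z : ℤ) : (z % (g : ℤ) ^ j).toNat < g ^ j := by
  have hp : (0 : ℤ) < (g : ℤ) ^ j := by positivity
  have h1 := Int.emod_nonneg z hp.ne'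
  have h2 := Int.emod_lt_of_pos z hp
  zify
  rw [Int.toNat_of_nonneg h1]
  exact h2

lemma residueDigitSum_add {g : ℕ} (hg : 2 ≤ g) (j l : ℕ) (z : ℤ) :
    residueDigitSum g (j + l) z = residueDigitSum g j z + residueDigitSum g l (z / (g : ℤ) ^ j) := by
  have hp : (0 : ℤ) < (g : ℤ) ^ j := by positivity
  have hq : (0 : ℤ) < (g : ℤ) ^ l := by positivity
  have key : z % (g : ℤ) ^ (j + l) = z % (g : ℤ) ^ j + (g : ℤ) ^ j * (z / (g : ℤ) ^ j % (g : ℤ) ^ l) := by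
    rw [pow_add]
    have h1 := Int.emod_add_mul_ediv z ((g : ℤ) ^ j)
    have h2 := Int.emod_add_mul_ediv (z / (g : ℤ) ^ j) ((g : ℤ) ^ l)
    have e1 := Int.emod_nonneg z hp.ne'
    have e2 := Int.emod_lt_of_pos z hp
    have e3 := Int.emod_nonneg (z / (g : ℤ) ^ j) hq.ne'
    have e4 := Int.emod_lt_of_pos (z / (g : ℤ) ^ j) hq
    rw [Int.emod_eq_iff (by positivity)]
    refine ⟨by positivity, ?_, ?_⟩
    · rw [Int.natAbs_of_nonneg (by positivity)]
      nlinarith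
    · refine ⟨-(z / (g : ℤ) ^ j / (g : ℤ) ^ l), ?_⟩
      linear_combination h1 + (g : ℤ) ^ j * h2
  unfold residueDigitSum
  have hn : (z % (g : ℤ) ^ (j + l)).toNat =
      (z % (g : ℤ) ^ j).toNat + g ^ j * (z / (g : ℤ) ^ j % (g : ℤ) ^ l).toNat := by
    zify
    rw [Int.toNat_of_nonneg (Int.emod_nonneg _ hp.ne'), Int.toNat_of_nonneg (Int.emod_nonneg _ hq.ne'),
      Int.toNat_of_nonneg (Int.emod_nonneg _ (by positivity)), key]
  rw [hn, digitSum_add_pow_mul hg j (toNat_emod_lt hg j z)]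
  push_cast
  rfl

lemma residueDigitSum_nonneg (g j : ℕ) (z : ℤ) : 0 ≤ residueDigitSum g j z := Nat.cast_nonneg _

lemma residueDigitSum_le {g : ℕ} (hg : 2 ≤ g) (j : ℕ) (z : ℤ) : residueDigitSum g j z ≤ j * g := by
  unfold residueDigitSum
  exact_mod_cast digitSum_le hg j (toNat_emod_lt hg j z)

lemma sum_range_mul_eq_sum_sum {M : Type*} [AddCommMonoid M] (m n : ℕ) (f : ℕ → M) :
    ∑ k ∈ Finset.range (m * n), f k =
      ∑ a ∈ Finset.range m, ∑ b ∈ Finset.range n, f (a + m * b) := by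
  induction n with
  | zero => simp
  | succ n ih =>
    simp only [Finset.sum_range_succ, Finset.sum_add_distrib]
    rw [Nat.mul_succ, Finset.sum_range_add, ih]
    congr 1
    exact Finset.sum_congr rfl fun a _ => by rw [add_comm]

lemma transferOp_add {g : ℕ} (hg : 2 ≤ g) (θ : Fin 3 → ℝ) (j l : ℕ) (f : ℤ → ℂ) (N : ℤ) :
    transferOp g θ (j + l) f N = transferOp g θ j (transferOp g θ l f) N := by
  have hp : (0 : ℤ) < (g : ℤ) ^ j := by positivity
  unfold transferOp
  rw [pow_add, sum_range_mul_eq_sum_sum]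
  simp only [sum_range_mul_eq_sum_sum (g ^ j) (g ^ l)]
  refine Finset.sum_congr rfl fun a ha => ?_
  rw [Finset.sum_comm]
  refine Finset.sum_congr rfl fun b hb => ?_
  rw [Finset.mul_sum]
  refine Finset.sum_congr rfl fun a' _ => ?_
  rw [Finset.mul_sum]
  refine Finset.sum_congr rfl fun b' _ => ?_
  have hz : (N - ((a + g ^ j * a' : ℕ) : ℤ) - ((b + g ^ j * b' : ℕ) : ℤ)) =
      (N - a - b) + (g : ℤ) ^ j * (-a' - b') := by push_cast; ring
  have hdiv : (N - ((a + g ^ j * a' : ℕ) : ℤ) - ((b + g ^ j * b' : ℕ) : ℤ)) / (g : ℤ) ^ j =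
      (N - a - b) / (g : ℤ) ^ j - a' - b' := by
    rw [hz, Int.add_mul_ediv_left _ _ hp.ne']; ring
  have hmod : residueDigitSum g j (N - ((a + g ^ j * a' : ℕ) : ℤ) - ((b + g ^ j * b' : ℕ) : ℤ)) =
      residueDigitSum g j (N - a - b) := by
    unfold residueDigitSum
    rw [hz, Int.add_mul_emod_self_left]
  rw [residueDigitSum_add hg, hdiv, hmod, digitSum_add_pow_mul hg j (Finset.mem_range.1 ha),
    digitSum_add_pow_mul hg j (Finset.mem_range.1 hb), pow_add,
    ← Int.ediv_ediv_of_nonneg hp.le, hdiv, ← mul_assoc, ← expI_add]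
  congr 2
  push_cast
  ring

lemma norm_transferOp_sub_le (g : ℕ) (θ : Fin 3 → ℝ) (j : ℕ) (f f' : ℤ → ℂ) (N : ℤ) (B : ℝ)
    (h : ∀ a < g ^ j, ∀ b < g ^ j, ‖f ((N - a - b) / (g : ℤ) ^ j) - f' ((N - a - b) / (g : ℤ) ^ j)‖ ≤ B) :
    ‖transferOp g θ j f N - transferOp g θ j f' N‖ ≤ (g : ℝ) ^ (2 * j) * B := by
  unfold transferOp
  simp only [← Finset.sum_sub_distrib]
  have : (g : ℝ) ^ (2 * j) * B =
      ∑ a ∈ Finset.range (g ^ j), ∑ b ∈ Finset.range (g ^ j), B := by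
    simp only [Finset.sum_const, Finset.card_range, nsmul_eq_mul]
    push_cast; ring
  rw [this]
  refine norm_sum_le_of_le _ fun a ha => norm_sum_le_of_le _ fun b hb => ?_
  rw [← mul_sub, norm_mul, norm_expI, one_mul]
  exact h a (Finset.mem_range.1 ha) b (Finset.mem_range.1 hb)

lemma norm_transferOp_le (g : ℕ) (θ : Fin 3 → ℝ) (j : ℕ) (f : ℤ → ℂ) (N : ℤ) (B : ℝ)
    (h : ∀ z, ‖f z‖ ≤ B) : ‖transferOp g θ j f N‖ ≤ (g : ℝ) ^ (2 * j) * B := by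
  have := norm_transferOp_sub_le g θ j f 0 N B (fun a _ b _ => by simpa using h _)
  simpa [transferOp] using this

lemma transferOp_const_mul (g : ℕ) (θ : Fin 3 → ℝ) (j : ℕ) (κ : ℂ) (N : ℤ) :
    transferOp g θ j (fun _ => κ) N = κ * transferOp g θ j (fun _ => 1) N := by
  unfold transferOp
  simp only [Finset.mul_sum]
  exact Finset.sum_congr rfl fun a _ => Finset.sum_congr rfl fun b _ => by ring

lemma norm_expI_add_expI_le {s t d : ℝ} (hd : t - s = d) (h : |d| ≤ Real.pi) :
    ‖expI s + expI t‖ ≤ 2 - d ^ 2 / 10 := by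
  have ht : t = s + d := by linarith
  have h10 : Real.pi ^ 2 ≤ 10 := by nlinarith [Real.pi_lt_d2, Real.pi_pos]
  have hd2 : d ^ 2 ≤ Real.pi ^ 2 := sq_le_sq' (abs_le.1 h).1 (abs_le.1 h).2
  have hc := Real.cos_le_one_sub_mul_cos_sq h
  have hc' : Real.cos d ≤ 1 - d ^ 2 / 5 := by
    have : d ^ 2 / 5 ≤ 2 / Real.pi ^ 2 * d ^ 2 := by
      rw [div_eq_mul_inv, mul_comm]
      refine mul_le_mul_of_nonneg_right ?_ (sq_nonneg d)
      rw [le_div_iff₀ (by positivity)]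
      linarith
    linarith
  rw [ht, expI_add, ← mul_one_add, norm_mul, norm_expI, one_mul]
  refine abs_le_of_sq_le_sq' ?_ (by nlinarith) |>.2
  have : ‖1 + expI d‖ ^ 2 = 2 + 2 * Real.cos d := by
    rw [Complex.sq_norm, Complex.normSq_apply, expI, mul_comm Complex.I]
    simp only [Complex.add_re, Complex.add_im, Complex.one_re, Complex.one_im,
      Complex.exp_ofReal_mul_I_re, Complex.exp_ofReal_mul_I_im]
    nlinarith [Real.sin_sq_add_cos_sq d]
  rw [this]
  nlinarith [sq_nonneg (d ^ 2)]

lemma norm_sum_le_of_pair {ι : Type*} [DecidableEq ι] (s : Finset ι) (F : ι → ℂ) (B C : ℝ)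
    {p q : ι} (hp : p ∈ s) (hq : q ∈ s) (hpq : p ≠ q) (hF : ∀ i ∈ s, ‖F i‖ ≤ B)
    (hC : ‖F p + F q‖ ≤ C) : ‖∑ i ∈ s, F i‖ ≤ ((s.card : ℝ) - 2) * B + C := by
  have hq' : q ∈ s.erase p := Finset.mem_erase.2 ⟨hpq.symm, hq⟩
  rw [← Finset.add_sum_erase s F hp, ← Finset.add_sum_erase _ F hq', ← add_assoc, add_comm]
  refine (norm_add_le _ _).trans (add_le_add ?_ hC)
  refine (norm_sum_le_of_le _ fun i hi =>
    hF i (Finset.mem_of_mem_erase (Finset.mem_of_mem_erase hi))).trans ?_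
  rw [Finset.sum_const, nsmul_eq_mul, Finset.card_erase_of_mem hq', Finset.card_erase_of_mem hp]
  have h2 : 2 ≤ s.card := Finset.one_lt_card.2 ⟨p, hp, q, hq, hpq⟩
  rw [Nat.sub_sub, Nat.cast_sub h2]
  norm_num

lemma norm_transferOp_two_le {g : ℕ} (θ : Fin 3 → ℝ) (f : ℤ → ℂ) (N : ℤ) {B d : ℝ}
    (hf : ∀ z, ‖f z‖ ≤ B) (hd : |d| ≤ Real.pi) {a b a' b' : ℕ} (ha : a < g ^ 2) (hb : b < g ^ 2)
    (ha' : a' < g ^ 2) (hb' : b' < g ^ 2) (hne : (a, b) ≠ (a', b'))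
    (hquot : (N - a - b) / (g : ℤ) ^ 2 = (N - a' - b') / (g : ℤ) ^ 2)
    (hphase : (θ 0 * digitSum g a' + θ 1 * digitSum g b' + θ 2 * residueDigitSum g 2 (N - a' - b')) -
      (θ 0 * digitSum g a + θ 1 * digitSum g b + θ 2 * residueDigitSum g 2 (N - a - b)) = d) :
    ‖transferOp g θ 2 f N‖ ≤ ((g : ℝ) ^ 4 - d ^ 2 / 10) * B := by
  unfold transferOp
  rw [← Finset.sum_product']
  refine (norm_sum_le_of_pair _ _ B ((2 - d ^ 2 / 10) * B) (p := (a, b)) (q := (a', b'))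
    (by simp [ha, hb]) (by simp [ha', hb']) hne (fun i _ => ?_) ?_).trans ?_
  · rw [norm_mul, norm_expI, one_mul]; exact hf _
  · simp only
    rw [hquot, ← add_mul, norm_mul]
    exact mul_le_mul (norm_expI_add_expI_le hphase hd) (hf _) (norm_nonneg _)
      ((norm_nonneg _).trans (norm_expI_add_expI_le hphase hd))
  · rw [Finset.card_product, Finset.card_range]
    push_cast
    apply le_of_eq
    ring

/-- The phases `θ` with `θ₁ - θ₀ = x₀`, `θ₂ - θ₀ = x₁` and `θ₀ + (g - 2) θ₁ = x₂`. -/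
def phaseOf (g : ℕ) (x : Fin 3 → ℝ) : Fin 3 → ℝ :=
  ![(x 2 - (g - 2) * x 0) / (g - 1), (x 2 - (g - 2) * x 0) / (g - 1) + x 0,
    (x 2 - (g - 2) * x 0) / (g - 1) + x 1]

lemma phaseOf_one_sub (g : ℕ) (x : Fin 3 → ℝ) : phaseOf g x 1 - phaseOf g x 0 = x 0 := by
  simp [phaseOf]

lemma phaseOf_two_sub (g : ℕ) (x : Fin 3 → ℝ) : phaseOf g x 2 - phaseOf g x 0 = x 1 := by
  simp [phaseOf]

lemma phaseOf_zero_add {g : ℕ} (hg : 2 ≤ g) (x : Fin 3 → ℝ) :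
    phaseOf g x 0 + (g - 2) * phaseOf g x 1 = x 2 := by
  have : (g : ℝ) - 1 ≠ 0 := by
    have : (2 : ℝ) ≤ g := by exact_mod_cast hg
    linarith
  simp [phaseOf]
  field_simp
  ring

lemma exists_norm_apply_eq (x : Fin 3 → ℝ) : ∃ i, |x i| = ‖x‖ := by
  obtain ⟨i, -, hi⟩ := Finset.exists_mem_eq_sup' Finset.univ_nonempty fun i => ‖x i‖₊
  refine ⟨i, ?_⟩
  rw [Pi.norm_def, ← Real.norm_eq_abs, ← coe_nnnorm, ← hi, Finset.sup'_eq_sup]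

lemma norm_transferOp_two_le_norm {g : ℕ} (hg : 2 ≤ g) (x : Fin 3 → ℝ) (hx : ‖x‖ ≤ Real.pi)
    (f : ℤ → ℂ) (N : ℤ) {B : ℝ} (hf : ∀ z, ‖f z‖ ≤ B) :
    ‖transferOp g (phaseOf g x) 2 f N‖ ≤ ((g : ℝ) ^ 4 - ‖x‖ ^ 2 / 10) * B := by
  have hg2 : g < g ^ 2 := by nlinarith
  have hd0 : digitSum g 0 = 0 := by simp [digitSum]
  have hd1 : digitSum g 1 = 1 := digitSum_of_lt hg (by omega)
  obtain ⟨i, hi⟩ := exists_norm_apply_eq x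
  have hxi : |x i| ≤ Real.pi := by rw [hi]; exact hx
  rw [← hi, sq_abs]
  fin_cases i
  · refine norm_transferOp_two_le (a := 1) (b := 0) (a' := 0) (b' := 1) _ f N hf hxi
      (by omega) (by omega) (by omega) (by omega) (by simp) (by simp) ?_
    simp only [hd0, hd1, Nat.cast_zero, Nat.cast_one, sub_zero]
    have := phaseOf_one_sub g x
    simp only [Fin.zero_eta]
    linear_combination this
  · have hp : (0 : ℤ) < (g : ℤ) ^ 2 := by positivity
    have hp1 : (1 : ℤ) < (g : ℤ) ^ 2 := by exact_mod_cast (by omega : 1 < g ^ 2)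
    set b := ((N - 1) % (g : ℤ) ^ 2).toNat with hb
    have hb' : (b : ℤ) = (N - 1) % (g : ℤ) ^ 2 :=
      Int.toNat_of_nonneg (Int.emod_nonneg _ hp.ne')
    have e := Int.emod_add_mul_ediv (N - 1) ((g : ℤ) ^ 2)
    have z0 : N - (1 : ℕ) - b = 0 + (g : ℤ) ^ 2 * ((N - 1) / (g : ℤ) ^ 2) := by
      rw [hb']; push_cast; linarith
    have z1 : N - (0 : ℕ) - b = 1 + (g : ℤ) ^ 2 * ((N - 1) / (g : ℤ) ^ 2) := by
      rw [hb']; push_cast; linarith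
    refine norm_transferOp_two_le (a := 1) (b := b) (a' := 0) (b' := b) _ f N hf hxi
      (by omega) (toNat_emod_lt hg 2 _) (by omega) (toNat_emod_lt hg 2 _) (by simp) ?_ ?_
    · rw [z0, z1, Int.add_mul_ediv_left _ _ hp.ne', Int.add_mul_ediv_left _ _ hp.ne',
        Int.ediv_eq_zero_of_lt (by norm_num) hp1]
      simp
    · unfold residueDigitSum
      rw [z0, z1, Int.add_mul_emod_self_left, Int.add_mul_emod_self_left,
        Int.emod_eq_of_lt zero_le_one hp1, Int.zero_emod, Int.toNat_one, Int.toNat_zero, hd0, hd1]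
      have := phaseOf_two_sub g x
      simp only [Fin.mk_one]
      push_cast
      linear_combination this
  · have hdg : digitSum g g = 1 := by
      have := digitSum_add_mul hg (d := 0) (by omega) 1
      rw [hd1] at this
      simpa using this
    have hdg' : digitSum g (g - 1) = g - 1 := digitSum_of_lt hg (by omega)
    have hN : N - (1 : ℕ) - ((g - 1 : ℕ) : ℤ) = N - (0 : ℕ) - (g : ℕ) := by
      rw [Nat.cast_sub (by omega)]; push_cast; ring
    refine norm_transferOp_two_le (a := 0) (b := g) (a' := 1) (b' := g - 1) _ f N hf hxi
      (by omega) (by omega) (by omega) (by omega) (by simp) (by rw [hN]) ?_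
    rw [hN, hd0, hd1, hdg, hdg', Nat.cast_sub (by omega)]
    have := phaseOf_zero_add hg x
    simp only [Fin.reduceFinMk]
    push_cast
    linear_combination this

lemma norm_transferOp_two_mul_le {g : ℕ} (hg : 2 ≤ g) (x : Fin 3 → ℝ) (hx : ‖x‖ ≤ Real.pi)
    (f : ℤ → ℂ) {B : ℝ} (hf : ∀ z, ‖f z‖ ≤ B) (n : ℕ) :
    ∀ N, ‖transferOp g (phaseOf g x) (2 * n) f N‖ ≤ ((g : ℝ) ^ 4 - ‖x‖ ^ 2 / 10) ^ n * B := by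
  induction n with
  | zero => intro N; simpa using norm_transferOp_le g (phaseOf g x) 0 f N B hf
  | succ n ih =>
    intro N
    rw [mul_add, mul_one, add_comm, transferOp_add hg]
    refine (norm_transferOp_two_le_norm hg x hx _ N ih).trans (le_of_eq ?_)
    ring

lemma norm_transferOp_le_exp {g : ℕ} (hg : 2 ≤ g) (x : Fin 3 → ℝ) (hx : ‖x‖ ≤ Real.pi)
    (f : ℤ → ℂ) {B : ℝ} (hB : 0 ≤ B) (hf : ∀ z, ‖f z‖ ≤ B) (K : ℕ) (N : ℤ) :
    ‖transferOp g (phaseOf g x) K f N‖ ≤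
      3 * (g : ℝ) ^ (2 * K) * B * Real.exp (-(K * ‖x‖ ^ 2 / (20 * (g : ℝ) ^ 4))) := by
  obtain ⟨n, r, hr, hK⟩ : ∃ n r, r ≤ 1 ∧ K = 2 * n + r :=
    ⟨K / 2, K % 2, by omega, by omega⟩
  have hx10 : ‖x‖ ^ 2 ≤ 10 := by nlinarith [Real.pi_lt_d2, Real.pi_pos, norm_nonneg x]
  have hg4 : (16 : ℝ) ≤ (g : ℝ) ^ 4 := by
    have : (2 : ℝ) ≤ g := by exact_mod_cast hg
    nlinarith [pow_le_pow_left₀ (by norm_num) this 4]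
  have h1 : ((g : ℝ) ^ 4 - ‖x‖ ^ 2 / 10) ^ n ≤
      (g : ℝ) ^ (4 * n) * Real.exp (-(n * (‖x‖ ^ 2 / (10 * (g : ℝ) ^ 4)))) := by
    have : (g : ℝ) ^ 4 - ‖x‖ ^ 2 / 10 ≤ (g : ℝ) ^ 4 * Real.exp (-(‖x‖ ^ 2 / (10 * (g : ℝ) ^ 4))) := by
      have e := Real.add_one_le_exp (-(‖x‖ ^ 2 / (10 * (g : ℝ) ^ 4)))
      calc (g : ℝ) ^ 4 - ‖x‖ ^ 2 / 10
          = (g : ℝ) ^ 4 * (-(‖x‖ ^ 2 / (10 * (g : ℝ) ^ 4)) + 1) := by field_simp; ring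
        _ ≤ _ := mul_le_mul_of_nonneg_left e (by positivity)
    refine (pow_le_pow_left₀ (by linarith) this n).trans (le_of_eq ?_)
    rw [mul_pow, ← pow_mul, ← Real.exp_nat_mul]
    congr 2
    ring
  rw [hK, transferOp_add hg]
  refine (norm_transferOp_two_mul_le hg x hx _ (fun z => norm_transferOp_le g _ r f z B hf) n N).trans ?_
  have h2 : Real.exp (-(n * (‖x‖ ^ 2 / (10 * (g : ℝ) ^ 4)))) ≤
      3 * Real.exp (-(((2 * n + r : ℕ) : ℝ) * ‖x‖ ^ 2 / (20 * (g : ℝ) ^ 4))) := by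
    have h3 : Real.exp 1 ≤ 3 := (Real.exp_one_lt_d9.trans (by norm_num)).le
    refine le_trans ?_ (mul_le_mul_of_nonneg_right h3 (Real.exp_pos _).le)
    rw [← Real.exp_add, Real.exp_le_exp]
    have hr' : (r : ℝ) ≤ 1 := by exact_mod_cast hr
    have : (r : ℝ) * ‖x‖ ^ 2 / (20 * (g : ℝ) ^ 4) ≤ 1 := by
      rw [div_le_one (by positivity)]
      nlinarith [sq_nonneg ‖x‖, (Nat.cast_nonneg r : (0 : ℝ) ≤ r)]
    have e : ((2 * n + r : ℕ) : ℝ) * ‖x‖ ^ 2 / (20 * (g : ℝ) ^ 4) =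
        n * (‖x‖ ^ 2 / (10 * (g : ℝ) ^ 4)) + (r : ℝ) * ‖x‖ ^ 2 / (20 * (g : ℝ) ^ 4) := by
      push_cast; field_simp; ring
    rw [e]
    linarith
  calc ((g : ℝ) ^ 4 - ‖x‖ ^ 2 / 10) ^ n * ((g : ℝ) ^ (2 * r) * B)
      ≤ ((g : ℝ) ^ (4 * n) * (3 * Real.exp (-(((2 * n + r : ℕ) : ℝ) * ‖x‖ ^ 2 / (20 * (g : ℝ) ^ 4))))) *
          ((g : ℝ) ^ (2 * r) * B) := by
        refine mul_le_mul_of_nonneg_right (h1.trans ?_) (by positivity)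
        exact mul_le_mul_of_nonneg_left h2 (by positivity)
    _ = _ := by
        rw [show 2 * (2 * n + r) = 4 * n + 2 * r by ring, pow_add]; ring

lemma residueDigitSum_one {g : ℕ} (hg : 2 ≤ g) (z : ℤ) :
    residueDigitSum g 1 z = ((z % (g : ℤ)).toNat : ℝ) := by
  have := toNat_emod_lt hg 1 z
  rw [pow_one, pow_one] at this
  rw [residueDigitSum, pow_one, digitSum_of_lt hg this]

lemma sum_range_residue {g : ℕ} (hg : 0 < g) (z : ℤ) (F : ℝ → ℝ) :
    ∑ b ∈ Finset.range g, F (((z - b) % (g : ℤ)).toNat : ℝ) = ∑ b ∈ Finset.range g, F b := by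
  have hp : (0 : ℤ) < g := by exact_mod_cast hg
  have hcast (b : ℕ) : ((((z - b) % (g : ℤ)).toNat : ℕ) : ℤ) = (z - b) % (g : ℤ) :=
    Int.toNat_of_nonneg (Int.emod_nonneg _ hp.ne')
  have hlt (b : ℕ) : ((z - b) % (g : ℤ)).toNat < g := by
    zify
    rw [hcast]
    exact Int.emod_lt_of_pos _ hp
  have hinv (b : ℕ) (hb : b ∈ Finset.range g) :
      ((z - (((z - b) % (g : ℤ)).toNat : ℕ)) % (g : ℤ)).toNat = b := by
    rw [hcast, Int.sub_emod_emod, sub_sub_cancel]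
    rw [Int.emod_eq_of_lt (by positivity) (by exact_mod_cast Finset.mem_range.1 hb)]
    simp
  exact Finset.sum_nbij' (fun b => ((z - b) % (g : ℤ)).toNat) (fun b => ((z - b) % (g : ℤ)).toNat)
    (fun b _ => Finset.mem_range.2 (hlt b)) (fun b _ => Finset.mem_range.2 (hlt b)) hinv hinv
    (fun b _ => rfl)

lemma sum_range_sub_mean (g : ℕ) :
    ∑ d ∈ Finset.range g, ((d : ℝ) - (g - 1) / 2) = 0 := by
  have h (n : ℕ) : ∑ d ∈ Finset.range n, (d : ℝ) = n * (n - 1) / 2 := by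
    induction n with
    | zero => simp
    | succ n ih => rw [Finset.sum_range_succ, ih]; push_cast; ring
  rw [Finset.sum_sub_distrib, h, Finset.sum_const, Finset.card_range, nsmul_eq_mul]
  ring

lemma sum_range_sub_mean_sq (g : ℕ) :
    ∑ d ∈ Finset.range g, ((d : ℝ) - (g - 1) / 2) ^ 2 = g * (((g : ℝ) ^ 2 - 1) / 12) := by
  have h (c : ℝ) (n : ℕ) : ∑ d ∈ Finset.range n, ((d : ℝ) - c) ^ 2 =
      n * (n - 1) * (2 * n - 1) / 6 - c * n * (n - 1) + n * c ^ 2 := by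
    induction n with
    | zero => simp
    | succ n ih => rw [Finset.sum_range_succ, ih]; push_cast; ring
  rw [h]
  ring

/-- The squared Euclidean length of `θ`. -/
def sqLen (θ : Fin 3 → ℝ) : ℝ := θ 0 ^ 2 + θ 1 ^ 2 + θ 2 ^ 2

lemma sqLen_nonneg (θ : Fin 3 → ℝ) : 0 ≤ sqLen θ := by unfold sqLen; positivity

lemma sq_apply_le_norm_sq (θ : Fin 3 → ℝ) (i : Fin 3) : θ i ^ 2 ≤ ‖θ‖ ^ 2 := by
  rw [← sq_abs]
  exact pow_le_pow_left₀ (abs_nonneg _) (norm_le_pi_norm θ i) 2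

lemma sqLen_le (θ : Fin 3 → ℝ) : sqLen θ ≤ 3 * ‖θ‖ ^ 2 := by
  unfold sqLen
  linarith [sq_apply_le_norm_sq θ 0, sq_apply_le_norm_sq θ 1, sq_apply_le_norm_sq θ 2]

lemma abs_dot_le (θ : Fin 3 → ℝ) {x y z B : ℝ} (hx : |x| ≤ B) (hy : |y| ≤ B) (hz : |z| ≤ B) :
    |θ 0 * x + θ 1 * y + θ 2 * z| ≤ 3 * (‖θ‖ * B) := by
  have h (i : Fin 3) {x : ℝ} (hx : |x| ≤ B) : |θ i * x| ≤ ‖θ‖ * B := by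
    rw [abs_mul]
    exact mul_le_mul (norm_le_pi_norm θ i) hx (abs_nonneg _) (norm_nonneg _)
  have h1 := abs_add_le (θ 0 * x + θ 1 * y) (θ 2 * z)
  have h2 := abs_add_le (θ 0 * x) (θ 1 * y)
  linarith [h 0 hx, h 1 hy, h 2 hz]

lemma norm_expI_sub_taylor_le {y : ℝ} (hy : |y| ≤ 1) :
    ‖expI y - (((1 - y ^ 2 / 2 : ℝ) : ℂ) + Complex.I * y)‖ ≤ |y| ^ 3 := by
  have hn : ‖Complex.I * (y : ℂ)‖ = |y| := by simp
  have h := Complex.exp_bound (x := Complex.I * y) (by rw [hn]; exact hy) (n := 3) (by norm_num)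
  rw [hn] at h
  have e : ∑ m ∈ Finset.range 3, (Complex.I * (y : ℂ)) ^ m / (m.factorial : ℂ) =
      ((1 - y ^ 2 / 2 : ℝ) : ℂ) + Complex.I * y := by
    simp [Finset.sum_range_succ, Nat.factorial, mul_pow, Complex.I_sq]
    ring
  rw [e] at h
  refine h.trans ?_
  have : (0 : ℝ) ≤ |y| ^ 3 := by positivity
  norm_num [Nat.factorial]
  linarith

/-- The digits of two uniform summands and of the third summand are pairwise uncorrelated. -/
lemma sum_sum_centred {g : ℕ} (hg : 2 ≤ g) (θ : Fin 3 → ℝ) (q : ℤ) (y : ℕ → ℕ → ℝ)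
    (hy : ∀ a b, y a b = θ 0 * (a - (g - 1) / 2) + θ 1 * (b - (g - 1) / 2) +
      θ 2 * ((((q - a - b) % (g : ℤ)).toNat : ℝ) - (g - 1) / 2)) :
    ∑ a ∈ Finset.range g, ∑ b ∈ Finset.range g, y a b = 0 ∧
    ∑ a ∈ Finset.range g, ∑ b ∈ Finset.range g, y a b ^ 2 =
      g ^ 2 * ((((g : ℝ) ^ 2 - 1) / 12) * sqLen θ) := by
  set c : ℝ := (g - 1) / 2 with hc
  have hm : ∑ d ∈ Finset.range g, ((d : ℝ) - c) = 0 := sum_range_sub_mean g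
  have hv : ∑ d ∈ Finset.range g, ((d : ℝ) - c) ^ 2 = g * (((g : ℝ) ^ 2 - 1) / 12) :=
    sum_range_sub_mean_sq g
  set r : ℕ → ℕ → ℝ := fun a b => (((q - a - b) % (g : ℤ)).toNat : ℝ) - c with hr
  have hrb (a : ℕ) : ∑ b ∈ Finset.range g, r a b = 0 := by
    rw [← hm]
    exact sum_range_residue (by omega) (q - a) fun t => t - c
  have hra (b : ℕ) : ∑ a ∈ Finset.range g, r a b = 0 := by
    rw [← hm, ← sum_range_residue (by omega) (q - b) fun t => t - c]
    exact Finset.sum_congr rfl fun a _ => by rw [hr]; simp only; rw [sub_right_comm]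
  have hrr (a : ℕ) : ∑ b ∈ Finset.range g, r a b ^ 2 = g * (((g : ℝ) ^ 2 - 1) / 12) := by
    rw [← hv]
    exact sum_range_residue (by omega) (q - a) fun t => (t - c) ^ 2
  have hy' (a b : ℕ) : y a b = θ 0 * (a - c) + θ 1 * (b - c) + θ 2 * r a b := hy a b
  constructor
  · simp only [hy', Finset.sum_add_distrib, ← Finset.mul_sum, hrb, hm, Finset.sum_const]
    rw [← Finset.smul_sum, hm]
    simp
  · have hsq (a b : ℕ) : y a b ^ 2 = θ 0 ^ 2 * (a - c) ^ 2 + θ 1 ^ 2 * (b - c) ^ 2 +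
        θ 2 ^ 2 * r a b ^ 2 + (2 * θ 0 * θ 1 * (a - c)) * (b - c) +
        (2 * θ 0 * θ 2 * (a - c)) * r a b + (2 * θ 1 * θ 2) * ((b - c) * r a b) := by
      rw [hy']; ring
    have hlast : ∑ a ∈ Finset.range g, ∑ b ∈ Finset.range g, ((b : ℝ) - c) * r a b = 0 := by
      rw [Finset.sum_comm]
      simp only [← Finset.mul_sum, hra, mul_zero, Finset.sum_const_zero]
    simp only [hsq, Finset.sum_add_distrib, ← Finset.mul_sum, hrb, hm, hv, hrr, hlast,
      Finset.sum_const, Finset.card_range, nsmul_eq_mul, mul_zero, add_zero]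
    unfold sqLen
    ring

lemma norm_transferOp_one_sub_le {g : ℕ} (hg : 2 ≤ g) (θ : Fin 3 → ℝ) (hθ : 3 * (g * ‖θ‖) ≤ 1)
    (q : ℤ) :
    ‖expI (-((θ 0 + θ 1 + θ 2) * ((g - 1) / 2))) * transferOp g θ 1 (fun _ => 1) q -
      ((g ^ 2 * Real.exp (-((((g : ℝ) ^ 2 - 1) / 12) * sqLen θ / 2)) : ℝ) : ℂ)‖ ≤
      28 * (g : ℝ) ^ 3 * ((g : ℝ) ^ 2 * ‖θ‖ ^ 3) := by
  have hg2 : (2 : ℝ) ≤ g := by exact_mod_cast hg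
  set y : ℕ → ℕ → ℝ := fun a b => θ 0 * (a - (g - 1) / 2) + θ 1 * (b - (g - 1) / 2) +
      θ 2 * ((((q - a - b) % (g : ℤ)).toNat : ℝ) - (g - 1) / 2) with hy
  obtain ⟨hs1, hs2⟩ := sum_sum_centred hg θ q y (fun _ _ => rfl)
  have hop : expI (-((θ 0 + θ 1 + θ 2) * ((g - 1) / 2))) * transferOp g θ 1 (fun _ => 1) q =
      ∑ a ∈ Finset.range g, ∑ b ∈ Finset.range g, expI (y a b) := by
    simp only [transferOp, pow_one, Finset.mul_sum]
    refine Finset.sum_congr rfl fun a ha => Finset.sum_congr rfl fun b hb => ?_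
    rw [mul_one, ← expI_add, digitSum_of_lt hg (Finset.mem_range.1 ha),
      digitSum_of_lt hg (Finset.mem_range.1 hb), residueDigitSum_one hg]
    congr 1
    simp only [hy]
    ring
  set x : ℝ := (((g : ℝ) ^ 2 - 1) / 12) * sqLen θ / 2 with hx
  have htay : ∑ a ∈ Finset.range g, ∑ b ∈ Finset.range g,
      ((((1 - y a b ^ 2 / 2 : ℝ) : ℂ) + Complex.I * y a b)) = ((g ^ 2 * (1 - x) : ℝ) : ℂ) := by
    simp only [Finset.sum_add_distrib, ← Finset.mul_sum, ← Complex.ofReal_sum, hs1,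
      Finset.sum_sub_distrib, ← Finset.sum_div, hs2]
    simp only [Finset.sum_const, Finset.card_range, nsmul_eq_mul, hx]
    push_cast
    ring
  have hyb {a b : ℕ} (ha : a < g) (hb : b < g) : |y a b| ≤ 3 * (‖θ‖ * g) := by
    have hb' {t : ℕ} (ht : t < g) : |(t : ℝ) - (g - 1) / 2| ≤ g := by
      have : (t : ℝ) ≤ g := by exact_mod_cast ht.le
      have : (0 : ℝ) ≤ t := by positivity
      rw [abs_le]; constructor <;> linarith
    have h3 := toNat_emod_lt hg 1 (q - a - b)
    rw [pow_one, pow_one] at h3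
    exact abs_dot_le θ (hb' ha) (hb' hb) (hb' h3)
  have hmain : ‖∑ a ∈ Finset.range g, ∑ b ∈ Finset.range g, expI (y a b) -
      ((g ^ 2 * (1 - x) : ℝ) : ℂ)‖ ≤ (g : ℝ) ^ 2 * (3 * (‖θ‖ * g)) ^ 3 := by
    rw [← htay]
    simp only [← Finset.sum_sub_distrib]
    have : (g : ℝ) ^ 2 * (3 * (‖θ‖ * g)) ^ 3 =
        ∑ a ∈ Finset.range g, ∑ b ∈ Finset.range g, (3 * (‖θ‖ * g)) ^ 3 := by
      simp only [Finset.sum_const, Finset.card_range, nsmul_eq_mul]; ring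
    rw [this]
    refine norm_sum_le_of_le _ fun a ha => norm_sum_le_of_le _ fun b hb => ?_
    have hb1 := hyb (Finset.mem_range.1 ha) (Finset.mem_range.1 hb)
    refine (norm_expI_sub_taylor_le (by linarith [mul_comm (g : ℝ) ‖θ‖])).trans ?_
    exact pow_le_pow_left₀ (abs_nonneg _) hb1 3
  have ht1 : (g : ℝ) * ‖θ‖ ≤ 1 := by linarith [mul_nonneg (by positivity : (0 : ℝ) ≤ g) (norm_nonneg θ)]
  have hx0 : 0 ≤ x := by
    have : (0 : ℝ) ≤ (g : ℝ) ^ 2 - 1 := by nlinarith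
    have := sqLen_nonneg θ
    positivity
  have hxle : x ≤ (g * ‖θ‖) ^ 2 := by
    have h1 := sqLen_le θ
    have : ((g : ℝ) ^ 2 - 1) * sqLen θ ≤ g ^ 2 * (3 * ‖θ‖ ^ 2) :=
      mul_le_mul (by linarith) h1 (sqLen_nonneg θ) (by positivity)
    rw [hx, mul_pow]
    nlinarith [mul_nonneg (sq_nonneg (g : ℝ)) (sq_nonneg ‖θ‖)]
  have hexp : |Real.exp (-x) - (1 - x)| ≤ (g * ‖θ‖) ^ 3 := by
    have hx1 : |-x| ≤ 1 := by
      rw [abs_neg, abs_of_nonneg hx0]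
      exact hxle.trans (pow_le_one₀ (by positivity) ht1)
    have h := Real.abs_exp_sub_one_sub_id_le hx1
    rw [neg_sq] at h
    rw [show Real.exp (-x) - (1 - x) = Real.exp (-x) - 1 - -x by ring]
    refine h.trans ((pow_le_pow_left₀ hx0 hxle 2).trans ?_)
    rw [← pow_mul]
    exact pow_le_pow_of_le_one (by positivity) ht1 (by norm_num)
  rw [hop]
  have hsplit := norm_sub_le_norm_sub_add_norm_sub
    (∑ a ∈ Finset.range g, ∑ b ∈ Finset.range g, expI (y a b)) ((g ^ 2 * (1 - x) : ℝ) : ℂ)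
    ((g ^ 2 * Real.exp (-x) : ℝ) : ℂ)
  refine hsplit.trans ?_
  have h2 : ‖((g ^ 2 * (1 - x) : ℝ) : ℂ) - ((g ^ 2 * Real.exp (-x) : ℝ) : ℂ)‖ ≤
      (g : ℝ) ^ 2 * (g * ‖θ‖) ^ 3 := by
    rw [← Complex.ofReal_sub, Complex.norm_real, Real.norm_eq_abs, ← mul_sub, abs_mul,
      abs_of_nonneg (by positivity), abs_sub_comm]
    exact mul_le_mul_of_nonneg_left hexp (by positivity)
  refine (add_le_add hmain h2).trans (le_of_eq ?_)
  ring

lemma norm_transferOp_one_const_sub_le {g : ℕ} (hg : 2 ≤ g) (θ : Fin 3 → ℝ)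
    (hθ : 3 * (g * ‖θ‖) ≤ 1) (j : ℕ) (N : ℤ) :
    ‖expI (-((θ 0 + θ 1 + θ 2) * ((g - 1) / 2) * j)) * transferOp g θ j (fun _ => 1) N -
      (((g : ℝ) ^ (2 * j) *
        Real.exp (-(j * ((((g : ℝ) ^ 2 - 1) / 12) * sqLen θ / 2))) : ℝ) : ℂ)‖ ≤
      j * (28 * (g : ℝ) ^ 3) * ((g : ℝ) ^ (2 * j) * ‖θ‖ ^ 3) := by
  set Θ : ℝ := (θ 0 + θ 1 + θ 2) * ((g - 1) / 2) with hΘ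
  set x : ℝ := (((g : ℝ) ^ 2 - 1) / 12) * sqLen θ / 2 with hx
  have hx0 : 0 ≤ x := by
    have hg2 : (2 : ℝ) ≤ g := by exact_mod_cast hg
    have : (0 : ℝ) ≤ (g : ℝ) ^ 2 - 1 := by nlinarith
    have := sqLen_nonneg θ
    positivity
  induction j with
  | zero => simp [transferOp, digitSum, residueDigitSum]
  | succ j ih =>
    set m : ℝ := g ^ 2 * Real.exp (-x) with hm
    have hm0 : 0 ≤ m := by positivity
    have hmle : m ≤ g ^ 2 := mul_le_of_le_one_right (by positivity) (Real.exp_le_one_iff.2 (by linarith))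
    have h1 (q : ℤ) : ‖transferOp g θ 1 (fun _ => 1) q - expI Θ * m‖ ≤
        28 * (g : ℝ) ^ 3 * ((g : ℝ) ^ 2 * ‖θ‖ ^ 3) := by
      have := norm_transferOp_one_sub_le hg θ hθ q
      have e : transferOp g θ 1 (fun _ => 1) q - expI Θ * m =
          expI Θ * (expI (-Θ) * transferOp g θ 1 (fun _ => 1) q - m) := by
        rw [mul_sub, ← mul_assoc, ← expI_add]; simp
      rw [e, norm_mul, norm_expI, one_mul]
      exact this
    have h2 := norm_transferOp_sub_le g θ j (transferOp g θ 1 fun _ => 1) (fun _ => expI Θ * m) N _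
      (fun a _ b _ => h1 _)
    rw [← transferOp_add hg, transferOp_const_mul g θ j (expI Θ * m)] at h2
    have e1 : expI (-(Θ * (j + 1 : ℕ))) * transferOp g θ (j + 1) (fun _ => 1) N -
        (((g : ℝ) ^ (2 * (j + 1)) * Real.exp (-((j + 1 : ℕ) * x)) : ℝ) : ℂ) =
        expI (-(Θ * (j + 1 : ℕ))) * (transferOp g θ (j + 1) (fun _ => 1) N -
          expI Θ * m * transferOp g θ j (fun _ => 1) N) +
        m * (expI (-(Θ * j)) * transferOp g θ j (fun _ => 1) N -
          (((g : ℝ) ^ (2 * j) * Real.exp (-(j * x)) : ℝ) : ℂ)) := by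
      have e2 : expI (-(Θ * j)) = expI (-(Θ * (j + 1 : ℕ))) * expI Θ := by
        rw [← expI_add]; congr 1; push_cast; ring
      have e3 : (g : ℝ) ^ (2 * (j + 1)) * Real.exp (-((j + 1 : ℕ) * x)) =
          m * ((g : ℝ) ^ (2 * j) * Real.exp (-(j * x))) := by
        have : Real.exp (-((j + 1 : ℕ) * x)) = Real.exp (-x) * Real.exp (-(j * x)) := by
          rw [← Real.exp_add]; congr 1; push_cast; ring
        rw [this, hm]; ring
      rw [e3, e2]
      push_cast
      ring
    rw [e1]
    refine (norm_add_le _ _).trans ?_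
    rw [norm_mul, norm_expI, one_mul, norm_mul, Complex.norm_real, Real.norm_of_nonneg hm0]
    refine (add_le_add h2 (mul_le_mul hmle ih (norm_nonneg _) (by positivity))).trans (le_of_eq ?_)
    push_cast
    ring

/-- The indicator function of `0`. -/
def indicatorZero (z : ℤ) : ℂ := if z = 0 then 1 else 0

lemma norm_indicatorZero_le (z : ℤ) : ‖indicatorZero z‖ ≤ 1 := by
  unfold indicatorZero; split_ifs <;> simp

lemma norm_transferOp_sub_transferOp_zero_le {g : ℕ} (hg : 2 ≤ g) (θ : Fin 3 → ℝ) (h : ℕ)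
    (f : ℤ → ℂ) (hf : ∀ z, ‖f z‖ ≤ 1) (q : ℤ) :
    ‖transferOp g θ h f q - transferOp g 0 h f q‖ ≤ (g : ℝ) ^ (2 * h) * (3 * (‖θ‖ * (h * g))) := by
  unfold transferOp
  simp only [← Finset.sum_sub_distrib]
  have : (g : ℝ) ^ (2 * h) * (3 * (‖θ‖ * (h * g))) =
      ∑ a ∈ Finset.range (g ^ h), ∑ b ∈ Finset.range (g ^ h), 3 * (‖θ‖ * (h * g)) := by
    simp only [Finset.sum_const, Finset.card_range, nsmul_eq_mul]
    push_cast; ring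
  rw [this]
  refine norm_sum_le_of_le _ fun a ha => norm_sum_le_of_le _ fun b hb => ?_
  have hd {a : ℕ} (ha : a ∈ Finset.range (g ^ h)) : |(digitSum g a : ℝ)| ≤ h * g := by
    rw [abs_of_nonneg (Nat.cast_nonneg _)]
    exact_mod_cast digitSum_le hg h (Finset.mem_range.1 ha)
  rw [← sub_mul, norm_mul]
  simp only [Pi.zero_apply, zero_mul, add_zero, expI_zero]
  refine (mul_le_of_le_one_right (norm_nonneg _) (hf _)).trans ?_
  refine (norm_expI_sub_one_le _).trans (abs_dot_le θ (hd ha) (hd hb) ?_)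
  rw [abs_of_nonneg (residueDigitSum_nonneg _ _ _)]
  exact residueDigitSum_le hg h _

lemma abs_sum_indicator_sub_max_le (G : ℕ) (hG : 0 < G) (t : ℤ) (ht : t ≤ G) :
    |∑ b ∈ Finset.range G, (if (t - b) / (G : ℤ) = 0 then (1 : ℝ) else 0) - t.toNat| ≤ 1 := by
  have hdiv (b : ℕ) : (t - b) / (G : ℤ) = 0 ↔ (b : ℤ) ≤ t ∧ t < b + G := by
    rw [Int.ediv_eq_iff_of_pos (by exact_mod_cast hG)]
    constructor <;> rintro ⟨h1, h2⟩ <;> constructor <;> linarith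
  rw [← Finset.sum_filter, Finset.sum_const, nsmul_eq_mul, mul_one]
  have key : t.toNat ≤ ((Finset.range G).filter fun b : ℕ => (t - b) / (G : ℤ) = 0).card + 1 ∧
      ((Finset.range G).filter fun b : ℕ => (t - b) / (G : ℤ) = 0).card ≤ t.toNat + 1 := by
    constructor
    · have hsub : Finset.Ico 1 t.toNat ⊆
          (Finset.range G).filter fun b : ℕ => (t - b) / (G : ℤ) = 0 := by
        intro b hb
        rw [Finset.mem_Ico] at hb
        rw [Finset.mem_filter, Finset.mem_range, hdiv]
        omega
      have := Finset.card_le_card hsub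
      rw [Nat.card_Ico] at this
      omega
    · have hsub : ((Finset.range G).filter fun b : ℕ => (t - b) / (G : ℤ) = 0) ⊆
          Finset.range (t.toNat + 1) := by
        intro b hb
        rw [Finset.mem_filter, Finset.mem_range, hdiv] at hb
        rw [Finset.mem_range]
        omega
      simpa using Finset.card_le_card hsub
  have h1 : (t.toNat : ℝ) ≤
      ((Finset.range G).filter fun b : ℕ => (t - b) / (G : ℤ) = 0).card + 1 := by
    exact_mod_cast key.1
  have h2 : (((Finset.range G).filter fun b : ℕ => (t - b) / (G : ℤ) = 0).card : ℝ) ≤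
      t.toNat + 1 := by
    exact_mod_cast key.2
  rw [abs_le]
  constructor <;> linarith

lemma sum_range_tsub (G : ℕ) : ∀ n ≤ G,
    ∑ a ∈ Finset.range G, ((n - a : ℕ) : ℝ) = n * (n + 1) / 2 := by
  induction G with
  | zero => intro n hn; simp [Nat.le_zero.1 hn]
  | succ G ih =>
    intro n hn
    rw [Finset.sum_range_succ']
    rcases n with _ | n
    · simp
    · simp only [Nat.add_sub_add_right]
      rw [ih n (by omega)]
      push_cast
      ring

lemma norm_transferOp_zero_indicatorZero_sub_le {g : ℕ} (hg : 2 ≤ g) (h : ℕ) (q : ℤ) (X : ℝ)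
    (hX0 : 0 ≤ X) (hXG : X ≤ (g : ℝ) ^ h) (hq1 : X - 3 ≤ q) (hq2 : q ≤ X) :
    ‖transferOp g 0 h indicatorZero q - ((X ^ 2 / 2 : ℝ) : ℂ)‖ ≤ 5 * (g : ℝ) ^ h := by
  set G := g ^ h with hG
  have hG0 : 0 < G := by positivity
  have hGr : (g : ℝ) ^ h = G := by push_cast [hG]; rfl
  have hGz : (g : ℤ) ^ h = G := by push_cast [hG]; rfl
  have hqG : q ≤ G := by
    have : (q : ℝ) ≤ (G : ℝ) := by linarith
    exact_mod_cast this
  rw [hGr] at hXG ⊢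
  have hop : transferOp g 0 h indicatorZero q =
      ((∑ a ∈ Finset.range G, ∑ b ∈ Finset.range G,
        (if (q - a - b) / (G : ℤ) = 0 then (1 : ℝ) else 0) : ℝ) : ℂ) := by
    simp [transferOp, indicatorZero, ← hG, hGz]
  rw [hop, ← Complex.ofReal_sub, Complex.norm_real, Real.norm_eq_abs]
  have h1 : |∑ a ∈ Finset.range G, ∑ b ∈ Finset.range G,
        (if (q - a - b) / (G : ℤ) = 0 then (1 : ℝ) else 0) -
        ∑ a ∈ Finset.range G, ((q.toNat - a : ℕ) : ℝ)| ≤ G := by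
    rw [← Finset.sum_sub_distrib]
    refine (Finset.abs_sum_le_sum_abs _ _).trans ?_
    have : (G : ℝ) = ∑ a ∈ Finset.range G, (1 : ℝ) := by simp
    rw [this]
    refine Finset.sum_le_sum fun a _ => ?_
    have := abs_sum_indicator_sub_max_le G hG0 (q - a) (by omega)
    rwa [show (q - a : ℤ).toNat = q.toNat - a by omega] at this
  rw [sum_range_tsub G _ (by omega)] at h1
  have hG1 : (1 : ℝ) ≤ G := by exact_mod_cast hG0
  have h2 : |(q.toNat : ℝ) * (q.toNat + 1) / 2 - X ^ 2 / 2| ≤ 4 * (G : ℝ) := by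
    have hn0 : (0 : ℝ) ≤ q.toNat := Nat.cast_nonneg _
    have hn1 : X - 3 ≤ q.toNat := by
      have : (q : ℝ) ≤ q.toNat := by exact_mod_cast Int.self_le_toNat q
      linarith
    have hn2 : (q.toNat : ℝ) ≤ X := by
      rcases le_total 0 q with h | h
      · have : ((q.toNat : ℤ) : ℝ) = q := by rw [Int.toNat_of_nonneg h]
        rw [← this] at hq2
        exact_mod_cast hq2
      · rw [Int.toNat_of_nonpos h]; simpa using hX0
    rw [abs_le]
    constructor <;> nlinarith
  have := abs_sub_le (∑ a ∈ Finset.range G, ∑ b ∈ Finset.range G,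
        (if (q - a - b) / (G : ℤ) = 0 then (1 : ℝ) else 0)) ((q.toNat : ℝ) * (q.toNat + 1) / 2)
        (X ^ 2 / 2)
  linarith

/-- The asymptotics of the generating function for small phases. -/
lemma norm_transferOp_indicatorZero_sub_le {g : ℕ} (hg : 2 ≤ g) (θ : Fin 3 → ℝ)
    (hθ : 3 * (g * ‖θ‖) ≤ 1) (j h M : ℕ) (hM : M ≤ g ^ (j + h)) :
    ‖expI (-((θ 0 + θ 1 + θ 2) * ((g - 1) / 2) * j)) * transferOp g θ (j + h) indicatorZero M -
      (((M : ℝ) ^ 2 / 2 * Real.exp (-(j * ((((g : ℝ) ^ 2 - 1) / 12) * sqLen θ / 2))) : ℝ) : ℂ)‖ ≤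
      (g : ℝ) ^ (2 * (j + h)) *
        (5 * ((g : ℝ) ^ h)⁻¹ + 3 * g * (h * ‖θ‖) + 28 * (g : ℝ) ^ 3 * (j * ‖θ‖ ^ 3)) := by
  have hg0 : (0 : ℝ) < g := by exact_mod_cast (by omega : 0 < g)
  set X : ℝ := M / (g : ℝ) ^ j with hX
  have hX0 : 0 ≤ X := by positivity
  have hXG : X ≤ (g : ℝ) ^ h := by
    rw [hX, div_le_iff₀ (by positivity), ← pow_add, add_comm]
    exact_mod_cast hM
  have hXX : X ^ 2 / 2 * (g : ℝ) ^ (2 * j) = (M : ℝ) ^ 2 / 2 := by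
    rw [hX, mul_comm 2 j, pow_mul]; field_simp
  have hinner : ∀ a < g ^ j, ∀ b < g ^ j,
      ‖transferOp g θ h indicatorZero (((M : ℤ) - a - b) / (g : ℤ) ^ j) - ((X ^ 2 / 2 : ℝ) : ℂ)‖ ≤
        (g : ℝ) ^ (2 * h) * (3 * (‖θ‖ * (h * g))) + 5 * (g : ℝ) ^ h := by
    intro a ha b hb
    set q : ℤ := ((M : ℤ) - a - b) / (g : ℤ) ^ j with hq
    have hp : (0 : ℤ) < (g : ℤ) ^ j := by positivity
    have e1 := Int.emod_add_mul_ediv ((M : ℤ) - a - b) ((g : ℤ) ^ j)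
    have e2 := Int.emod_nonneg ((M : ℤ) - a - b) hp.ne'
    have e3 := Int.emod_lt_of_pos ((M : ℤ) - a - b) hp
    rw [← hq] at e1
    have ha' : (a : ℤ) < (g : ℤ) ^ j := by exact_mod_cast ha
    have hb' : (b : ℤ) < (g : ℤ) ^ j := by exact_mod_cast hb
    have f1 : (g : ℤ) ^ j * q ≤ M := by linarith [Int.natCast_nonneg a, Int.natCast_nonneg b]
    have f2 : (M : ℤ) ≤ (g : ℤ) ^ j * (q + 3) := by linarith
    have f1' : (g : ℝ) ^ j * q ≤ M := by exact_mod_cast f1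
    have f2' : (M : ℝ) ≤ (g : ℝ) ^ j * (q + 3) := by exact_mod_cast f2
    have hq1 : X - 3 ≤ q := by
      have : X ≤ q + 3 := by
        rw [hX, div_le_iff₀ (by positivity), mul_comm]; exact f2'
      linarith
    have hq2 : (q : ℝ) ≤ X := by
      rw [hX, le_div_iff₀ (by positivity), mul_comm]; exact f1'
    exact (norm_sub_le_norm_sub_add_norm_sub _ (transferOp g 0 h indicatorZero q) _).trans
      (add_le_add (norm_transferOp_sub_transferOp_zero_le hg θ h _ norm_indicatorZero_le q)
        (norm_transferOp_zero_indicatorZero_sub_le hg h q X hX0 hXG hq1 hq2))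
  have h1 := norm_transferOp_sub_le g θ j (transferOp g θ h indicatorZero)
    (fun _ => ((X ^ 2 / 2 : ℝ) : ℂ)) M _ hinner
  rw [← transferOp_add hg, transferOp_const_mul g θ j ((X ^ 2 / 2 : ℝ) : ℂ)] at h1
  have h2 := norm_transferOp_one_const_sub_le hg θ hθ j M
  set E := expI (-((θ 0 + θ 1 + θ 2) * ((g - 1) / 2) * j)) with hE
  set w := Real.exp (-(j * ((((g : ℝ) ^ 2 - 1) / 12) * sqLen θ / 2))) with hw
  have e : E * transferOp g θ (j + h) indicatorZero M - (((M : ℝ) ^ 2 / 2 * w : ℝ) : ℂ) =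
      E * (transferOp g θ (j + h) indicatorZero M -
        ((X ^ 2 / 2 : ℝ) : ℂ) * transferOp g θ j (fun _ => 1) M) +
      ((X ^ 2 / 2 : ℝ) : ℂ) * (E * transferOp g θ j (fun _ => 1) M -
        (((g : ℝ) ^ (2 * j) * w : ℝ) : ℂ)) := by
    rw [← hXX]; push_cast; ring
  rw [e]
  refine (norm_add_le _ _).trans ?_
  rw [norm_mul, hE, norm_expI, one_mul, ← hE, norm_mul, Complex.norm_real,
    Real.norm_of_nonneg (by positivity)]
  have hX2 : X ^ 2 / 2 ≤ (g : ℝ) ^ (2 * h) := by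
    have := pow_le_pow_left₀ hX0 hXG 2
    rw [← pow_mul, mul_comm h 2] at this
    linarith [sq_nonneg X]
  refine (add_le_add h1 (mul_le_mul hX2 h2 (norm_nonneg _) (by positivity))).trans (le_of_eq ?_)
  rw [show 2 * (j + h) = 2 * j + h + h by ring, show 2 * h = h + h by ring, pow_add, pow_add,
    pow_add]
  field_simp
  ring

lemma norm_phase_sub_gaussian_le {g : ℕ} (hg : 2 ≤ g) (θ : Fin 3 → ℝ)
    (hθ : 3 * (g * ‖θ‖) ≤ 1) (j h M : ℕ) (hM : M ≤ g ^ (j + h)) {k₀ k₁ k₂ C : ℝ} (hC : 0 ≤ C)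
    (h₀ : |k₀ - muK g (j + h)| ≤ C) (h₁ : |k₁ - muK g (j + h)| ≤ C)
    (h₂ : |k₂ - muK g (j + h)| ≤ C) :
    ‖expI (-(θ 0 * k₀ + θ 1 * k₁ + θ 2 * k₂)) * transferOp g θ (j + h) indicatorZero M -
      (((M : ℝ) ^ 2 / 2 *
        Real.exp (-(((g : ℝ) ^ 2 - 1) / 24 * ((j + h : ℕ) : ℝ) * sqLen θ)) : ℝ) : ℂ)‖ ≤
      (g : ℝ) ^ (2 * (j + h)) * (5 * ((g : ℝ) ^ h)⁻¹ + (3 * C + 7 * (g : ℝ) ^ 2) * ((h + 1) * ‖θ‖) +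
        28 * (g : ℝ) ^ 3 * (((j + h : ℕ) : ℝ) * ‖θ‖ ^ 3)) := by
  have hg2 : (2 : ℝ) ≤ g := by exact_mod_cast hg
  have hθ0 : 0 ≤ ‖θ‖ := norm_nonneg θ
  have hθ1 : ‖θ‖ ≤ 1 := by nlinarith
  set F := transferOp g θ (j + h) indicatorZero M with hF
  set P := (g : ℝ) ^ (2 * (j + h)) with hP
  have hP0 : 0 < P := by positivity
  have hFP : ‖F‖ ≤ P := by
    simpa using norm_transferOp_le g θ (j + h) indicatorZero M 1 norm_indicatorZero_le
  have hMP : (M : ℝ) ^ 2 / 2 ≤ P := by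
    have : (M : ℝ) ≤ (g : ℝ) ^ (j + h) := by exact_mod_cast hM
    have := pow_le_pow_left₀ (Nat.cast_nonneg M) this 2
    rw [← pow_mul, mul_comm (j + h) 2] at this
    linarith [sq_nonneg (M : ℝ)]
  set x : ℝ := (((g : ℝ) ^ 2 - 1) / 12) * sqLen θ / 2 with hx
  have hg21 : (0 : ℝ) ≤ (g : ℝ) ^ 2 - 1 := by nlinarith
  have hx0 : 0 ≤ x := by
    have := sqLen_nonneg θ
    positivity
  have hxle : x ≤ (g : ℝ) ^ 2 * ‖θ‖ := by
    have h3 := sqLen_le θ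
    have h4 : ‖θ‖ ^ 2 ≤ ‖θ‖ := by nlinarith
    have : ((g : ℝ) ^ 2 - 1) * sqLen θ ≤ g ^ 2 * (3 * ‖θ‖) :=
      mul_le_mul (by linarith) (by linarith) (sqLen_nonneg θ) (by positivity)
    have : 0 ≤ (g : ℝ) ^ 2 * ‖θ‖ := by positivity
    rw [hx]
    linarith
  have hmain := norm_transferOp_indicatorZero_sub_le hg θ hθ j h M hM
  rw [← hF, ← hP, ← hx] at hmain
  set Θ : ℝ := (θ 0 + θ 1 + θ 2) * ((g - 1) / 2) * j with hΘ
  have hk {k : ℝ} (hk : |k - muK g (j + h)| ≤ C) : |(g - 1) / 2 * j - k| ≤ C + g * h := by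
    have e : ((g : ℝ) - 1) / 2 * j - k = -(k - muK g (j + h)) - (g - 1) / 2 * h := by
      unfold muK; push_cast; ring
    rw [e]
    refine (abs_sub _ _).trans (add_le_add (by rwa [abs_neg]) ?_)
    rw [abs_of_nonneg (by have : (0 : ℝ) ≤ g - 1 := by linarith
                          positivity)]
    have : (0 : ℝ) ≤ h := Nat.cast_nonneg h
    nlinarith
  have hρ : ‖expI (-(θ 0 * k₀ + θ 1 * k₁ + θ 2 * k₂)) - expI (-Θ)‖ ≤
      3 * (‖θ‖ * (C + g * h)) := by
    have e : expI (-(θ 0 * k₀ + θ 1 * k₁ + θ 2 * k₂)) - expI (-Θ) =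
        expI (-Θ) * (expI (θ 0 * ((g - 1) / 2 * j - k₀) + θ 1 * ((g - 1) / 2 * j - k₁) +
          θ 2 * ((g - 1) / 2 * j - k₂)) - 1) := by
      rw [mul_sub, ← expI_add, mul_one]
      congr 2
      rw [hΘ]; ring
    rw [e, norm_mul, norm_expI, one_mul]
    exact (norm_expI_sub_one_le _).trans (abs_dot_le θ (hk h₀) (hk h₁) (hk h₂))
  have hexp : |Real.exp (-(j * x)) - Real.exp (-(((g : ℝ) ^ 2 - 1) / 24 * ((j + h : ℕ) : ℝ) * sqLen θ))| ≤
      h * ((g : ℝ) ^ 2 * ‖θ‖) := by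
    have e : Real.exp (-(((g : ℝ) ^ 2 - 1) / 24 * ((j + h : ℕ) : ℝ) * sqLen θ)) =
        Real.exp (-(j * x)) * Real.exp (-(h * x)) := by
      rw [← Real.exp_add, hx]; congr 1; push_cast; ring
    have h1 : Real.exp (-(h * x)) ≤ 1 := Real.exp_le_one_iff.2 (by
      have : 0 ≤ h * x := by positivity
      linarith)
    have h2 := Real.add_one_le_exp (-(h * x))
    have h3 : Real.exp (-(j * x)) ≤ 1 := Real.exp_le_one_iff.2 (by
      have : 0 ≤ j * x := by positivity
      linarith)
    rw [e, ← mul_one_sub, abs_mul, abs_of_pos (Real.exp_pos _), abs_of_nonneg (by linarith)]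
    calc Real.exp (-(j * x)) * (1 - Real.exp (-(h * x))) ≤ 1 * (h * x) :=
          mul_le_mul h3 (by linarith) (by linarith) zero_le_one
      _ ≤ _ := by rw [one_mul]; exact mul_le_mul_of_nonneg_left hxle (Nat.cast_nonneg h)
  set w := Real.exp (-(((g : ℝ) ^ 2 - 1) / 24 * ((j + h : ℕ) : ℝ) * sqLen θ)) with hw
  have e : expI (-(θ 0 * k₀ + θ 1 * k₁ + θ 2 * k₂)) * F - (((M : ℝ) ^ 2 / 2 * w : ℝ) : ℂ) =
      (expI (-(θ 0 * k₀ + θ 1 * k₁ + θ 2 * k₂)) - expI (-Θ)) * F +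
      (expI (-Θ) * F - (((M : ℝ) ^ 2 / 2 * Real.exp (-(j * x)) : ℝ) : ℂ)) +
      (((M : ℝ) ^ 2 / 2 * (Real.exp (-(j * x)) - w) : ℝ) : ℂ) := by
    push_cast; ring
  rw [e]
  refine norm_add₃_le.trans ?_
  have t1 : ‖(expI (-(θ 0 * k₀ + θ 1 * k₁ + θ 2 * k₂)) - expI (-Θ)) * F‖ ≤
      3 * (‖θ‖ * (C + g * h)) * P := by
    rw [norm_mul]
    exact mul_le_mul hρ hFP (norm_nonneg _) (by positivity)
  have t3 : ‖(((M : ℝ) ^ 2 / 2 * (Real.exp (-(j * x)) - w) : ℝ) : ℂ)‖ ≤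
      P * (h * ((g : ℝ) ^ 2 * ‖θ‖)) := by
    rw [Complex.norm_real, Real.norm_eq_abs, abs_mul, abs_of_nonneg (by positivity)]
    exact mul_le_mul hMP hexp (abs_nonneg _) hP0.le
  refine (add_le_add (add_le_add t1 hmain) t3).trans ?_
  have hj : (j : ℝ) * ‖θ‖ ^ 3 ≤ ((j + h : ℕ) : ℝ) * ‖θ‖ ^ 3 := by
    refine mul_le_mul_of_nonneg_right ?_ (by positivity)
    push_cast
    linarith [(Nat.cast_nonneg h : (0 : ℝ) ≤ h)]
  have hj' : 28 * (g : ℝ) ^ 3 * (j * ‖θ‖ ^ 3) ≤ 28 * (g : ℝ) ^ 3 * (((j + h : ℕ) : ℝ) * ‖θ‖ ^ 3) :=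
    mul_le_mul_of_nonneg_left hj (by positivity)
  have hh0 : 0 ≤ (h : ℝ) * ‖θ‖ := by positivity
  have hgg : (g : ℝ) ≤ g ^ 2 := by nlinarith
  have hgh : 6 * ((g : ℝ) * (h * ‖θ‖)) ≤ 6 * ((g : ℝ) ^ 2 * (h * ‖θ‖)) := by
    have := mul_le_mul_of_nonneg_right hgg hh0
    linarith
  have hfin : 3 * (‖θ‖ * (C + g * h)) + (5 * ((g : ℝ) ^ h)⁻¹ + 3 * g * (h * ‖θ‖) +
      28 * (g : ℝ) ^ 3 * (j * ‖θ‖ ^ 3)) + h * ((g : ℝ) ^ 2 * ‖θ‖) ≤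
      5 * ((g : ℝ) ^ h)⁻¹ + (3 * C + 7 * (g : ℝ) ^ 2) * ((h + 1) * ‖θ‖) +
        28 * (g : ℝ) ^ 3 * (((j + h : ℕ) : ℝ) * ‖θ‖ ^ 3) := by
    have p1 : 0 ≤ C * (h * ‖θ‖) := by positivity
    have p2 : 0 ≤ (g : ℝ) ^ 2 * ‖θ‖ := by positivity
    linarith
  calc _ = P * (3 * (‖θ‖ * (C + g * h)) + (5 * ((g : ℝ) ^ h)⁻¹ + 3 * g * (h * ‖θ‖) +
      28 * (g : ℝ) ^ 3 * (j * ‖θ‖ ^ 3)) + h * ((g : ℝ) ^ 2 * ‖θ‖)) := by ring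
    _ ≤ _ := mul_le_mul_of_nonneg_left hfin hP0.le

lemma norm_phaseOf_le {g : ℕ} (hg : 2 ≤ g) (x : Fin 3 → ℝ) : ‖phaseOf g x‖ ≤ 2 * ‖x‖ := by
  have hg2 : (2 : ℝ) ≤ g := by exact_mod_cast hg
  have hx (i : Fin 3) : |x i| ≤ ‖x‖ := norm_le_pi_norm x i
  have h0 : |(x 2 - (g - 2) * x 0) / (g - 1)| ≤ ‖x‖ := by
    have b0 := abs_le.1 (hx 0)
    have b2 := abs_le.1 (hx 2)
    rw [abs_div, abs_of_pos (by linarith : (0 : ℝ) < g - 1), div_le_iff₀ (by linarith), abs_le]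
    constructor <;> nlinarith
  have h1 := abs_add_le ((x 2 - (g - 2) * x 0) / (g - 1)) (x 0)
  have h2 := abs_add_le ((x 2 - (g - 2) * x 0) / (g - 1)) (x 1)
  rw [pi_norm_le_iff_of_nonneg (by positivity)]
  intro i
  rw [Real.norm_eq_abs]
  fin_cases i <;> simp [phaseOf] <;> linarith [hx 0, hx 1, norm_nonneg x]

lemma norm_sq_le_sqLen_phaseOf {g : ℕ} (hg : 2 ≤ g) (x : Fin 3 → ℝ) :
    ‖x‖ ^ 2 ≤ (g : ℝ) ^ 2 * sqLen (phaseOf g x) := by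
  have hg2 : (2 : ℝ) ≤ g := by exact_mod_cast hg
  obtain ⟨i, hi⟩ := exists_norm_apply_eq x
  rw [← hi, sq_abs]
  have e0 := phaseOf_one_sub g x
  have e1 := phaseOf_two_sub g x
  have e2 := phaseOf_zero_add hg x
  set θ := phaseOf g x
  have hs := sqLen_nonneg θ
  have h2 : 2 * sqLen θ ≤ (g : ℝ) ^ 2 * sqLen θ := mul_le_mul_of_nonneg_right (by nlinarith) hs
  unfold sqLen at *
  fin_cases i
  · simp only [Fin.zero_eta]
    rw [← e0]
    nlinarith [sq_nonneg (θ 1 + θ 0), sq_nonneg (θ 2)]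
  · simp only [Fin.mk_one]
    rw [← e1]
    nlinarith [sq_nonneg (θ 2 + θ 0), sq_nonneg (θ 1)]
  · simp only [Fin.reduceFinMk]
    rw [← e2]
    have h3 : (1 + ((g : ℝ) - 2) ^ 2) * (θ 0 ^ 2 + θ 1 ^ 2 + θ 2 ^ 2) ≤
        (g : ℝ) ^ 2 * (θ 0 ^ 2 + θ 1 ^ 2 + θ 2 ^ 2) := mul_le_mul_of_nonneg_right (by nlinarith) hs
    nlinarith [sq_nonneg (θ 1 - (g - 2) * θ 0), mul_nonneg (sq_nonneg ((g : ℝ) - 2)) (sq_nonneg (θ 2)),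
      sq_nonneg (θ 2)]

lemma integral_Icc_expI (n : ℤ) :
    ∫ t in Set.Icc (-Real.pi) Real.pi, expI (n * t) = if n = 0 then ((2 * Real.pi : ℝ) : ℂ) else 0 := by
  rw [MeasureTheory.integral_Icc_eq_integral_Ioc,
    ← intervalIntegral.integral_of_le (by linarith [Real.pi_pos])]
  split_ifs with h
  · simp [h]; ring
  · have hc : Complex.I * (n : ℂ) ≠ 0 := mul_ne_zero Complex.I_ne_zero (by exact_mod_cast h)
    have e : (fun t : ℝ => expI (n * t)) = fun t : ℝ => Complex.exp (Complex.I * n * t) := by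
      ext t; simp [expI, mul_assoc]
    rw [e, integral_exp_mul_complex hc, div_eq_zero_iff]
    left
    rw [sub_eq_zero, Complex.exp_eq_exp_iff_exists_int]
    refine ⟨n, ?_⟩
    push_cast
    ring

lemma integral_closedBall_expI (n : Fin 3 → ℤ) :
    ∫ x in Metric.closedBall (0 : Fin 3 → ℝ) Real.pi, expI (n 0 * x 0 + n 1 * x 1 + n 2 * x 2) =
      if n = 0 then (((2 * Real.pi) ^ 3 : ℝ) : ℂ) else 0 := by
  rw [closedBall_pi _ Real.pi_pos.le]
  simp only [Real.closedBall_eq_Icc, Pi.zero_apply, zero_sub, zero_add]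
  rw [MeasureTheory.volume_pi, MeasureTheory.Measure.restrict_pi_pi]
  have e : (fun x : Fin 3 → ℝ => expI (n 0 * x 0 + n 1 * x 1 + n 2 * x 2)) =
      fun x => ∏ i, (fun t : ℝ => expI (n i * t)) (x i) := by
    ext x; simp [Fin.prod_univ_three, expI_add]
  rw [e, MeasureTheory.integral_fintype_prod_eq_prod (fun i (t : ℝ) => expI (n i * t))]
  simp only [integral_Icc_expI, Fin.prod_univ_three]
  by_cases h : n = 0
  · simp [h]; ring
  · rw [if_neg h]
    obtain ⟨i, hi⟩ := Function.ne_iff.1 h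
    fin_cases i <;> simp at hi <;> simp [hi]

lemma continuous_expI : Continuous expI := by unfold expI; fun_prop

lemma continuous_phaseOf (g : ℕ) : Continuous (phaseOf g) := by
  refine continuous_pi fun i => ?_
  fin_cases i <;> simp [phaseOf] <;> fun_prop

lemma continuous_transferOp (g j : ℕ) (f : ℤ → ℂ) (N : ℤ) :
    Continuous fun θ => transferOp g θ j f N := by
  unfold transferOp
  refine continuous_finsetSum _ fun a _ => continuous_finsetSum _ fun b _ =>
    Continuous.mul (continuous_expI.comp (by fun_prop)) continuous_const

/-- The matrix of `phaseOf g`. -/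
def phaseMatrix (g : ℕ) : Matrix (Fin 3) (Fin 3) ℝ :=
  !![-(g - 2) / (g - 1), 0, 1 / (g - 1); 1 - (g - 2) / (g - 1), 0, 1 / (g - 1);
    -(g - 2) / (g - 1), 1, 1 / (g - 1)]

lemma toLin'_phaseMatrix (g : ℕ) : ⇑(Matrix.toLin' (phaseMatrix g)) = phaseOf g := by
  ext x i
  fin_cases i <;> simp [phaseMatrix, phaseOf, Matrix.mulVec, dotProduct, Fin.sum_univ_three] <;> ring

lemma integral_comp_phaseOf {g : ℕ} (hg : 2 ≤ g) {f : (Fin 3 → ℝ) → ℝ} (hf : Continuous f) :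
    ∫ x, f (phaseOf g x) = (g - 1) * ∫ θ, f θ := by
  have hg2 : (2 : ℝ) ≤ g := by exact_mod_cast hg
  have hg1 : (g : ℝ) - 1 ≠ 0 := by linarith
  have hdet : (phaseMatrix g).det = 1 / ((g : ℝ) - 1) := by
    simp [phaseMatrix, Matrix.det_fin_three]
    field_simp
    ring
  have h := Real.map_matrix_volume_pi_eq_smul_volume_pi (M := phaseMatrix g)
    (by rw [hdet]; exact one_div_ne_zero hg1)
  rw [toLin'_phaseMatrix, hdet] at h
  have hi := MeasureTheory.integral_map (μ := MeasureTheory.volume) (φ := phaseOf g) (f := f)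
    (continuous_phaseOf g).measurable.aemeasurable hf.aestronglyMeasurable
  rw [← hi, h, MeasureTheory.integral_smul_measure, ENNReal.toReal_ofReal (abs_nonneg _)]
  have : |(1 / ((g : ℝ) - 1))⁻¹| = g - 1 := by
    rw [one_div, inv_inv, abs_of_nonneg (by linarith)]
  rw [this, smul_eq_mul]

lemma continuous_sqLen : Continuous sqLen := by unfold sqLen; fun_prop

lemma integral_exp_neg_sqLen_phaseOf {g : ℕ} (hg : 2 ≤ g) (b : ℝ) :
    ∫ x, Real.exp (-(b * sqLen (phaseOf g x))) = (g - 1) * √(Real.pi / b) ^ 3 := by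
  rw [integral_comp_phaseOf hg (f := fun θ => Real.exp (-(b * sqLen θ)))
    (Real.continuous_exp.comp (continuous_const.mul continuous_sqLen).neg)]
  have e : (fun θ : Fin 3 → ℝ => Real.exp (-(b * sqLen θ))) =
      fun θ => ∏ i, (fun t : ℝ => Real.exp (-b * t ^ 2)) (θ i) := by
    ext θ
    simp only [Fin.prod_univ_three, ← Real.exp_add, sqLen]
    congr 1; ring
  rw [e, MeasureTheory.integral_fintype_prod_volume_eq_pow (fun t : ℝ => Real.exp (-b * t ^ 2)),
    integral_gaussian, Fintype.card_fin]

lemma integrable_exp_neg_sqLen_phaseOf {g : ℕ} (hg : 2 ≤ g) {b : ℝ} (hb : 0 < b) :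
    MeasureTheory.Integrable fun x => Real.exp (-(b * sqLen (phaseOf g x))) := by
  by_contra h
  have h0 := MeasureTheory.integral_undef h
  rw [integral_exp_neg_sqLen_phaseOf hg] at h0
  have hg2 : (2 : ℝ) ≤ g := by exact_mod_cast hg
  have : (0 : ℝ) < g - 1 := by linarith
  have : 0 < (g - 1) * √(Real.pi / b) ^ 3 := by have := Real.pi_pos; positivity
  linarith

lemma integral_closedBall_expI_phaseOf {g : ℕ} (hg : 2 ≤ g) (y : Fin 3 → ℤ)
    (hy : (g : ℤ) - 1 ∣ y 0 + y 1 + y 2) :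
    ∫ x in Metric.closedBall (0 : Fin 3 → ℝ) Real.pi,
      expI (phaseOf g x 0 * y 0 + phaseOf g x 1 * y 1 + phaseOf g x 2 * y 2) =
      if y = 0 then (((2 * Real.pi) ^ 3 : ℝ) : ℂ) else 0 := by
  obtain ⟨d, hd⟩ := hy
  have e (x : Fin 3 → ℝ) : phaseOf g x 0 * y 0 + phaseOf g x 1 * y 1 + phaseOf g x 2 * y 2 =
      (![y 1 - (g - 2) * d, y 2, d] 0 : ℤ) * x 0 + (![y 1 - (g - 2) * d, y 2, d] 1 : ℤ) * x 1 +
        (![y 1 - (g - 2) * d, y 2, d] 2 : ℤ) * x 2 := by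
    have h0 := phaseOf_one_sub g x
    have h1 := phaseOf_two_sub g x
    have h2 := phaseOf_zero_add hg x
    have hd' : (y 0 : ℝ) + y 1 + y 2 = (g - 1) * d := by exact_mod_cast hd
    simp only [Matrix.cons_val]
    push_cast
    linear_combination (phaseOf g x 0) * hd' + (y 1 - (g - 2) * d) * h0 + y 2 * h1 + d * h2
  simp only [e]
  rw [integral_closedBall_expI]
  congr 1
  refine propext ⟨fun h => ?_, fun h => ?_⟩
  · have h0 := congrFun h 0
    have h1 := congrFun h 1
    have h2 := congrFun h 2
    simp only [Matrix.cons_val, Pi.zero_apply] at h0 h1 h2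
    subst h2
    ext i
    fin_cases i <;> simp <;> linarith
  · have hg1 : (g : ℤ) - 1 ≠ 0 := by omega
    have : d = 0 := by simpa [h, hg1] using hd.symm
    ext i
    fin_cases i <;> simp [h, this]

lemma modEq_digitSum {g : ℕ} (hg : 3 ≤ g) (n : ℕ) : (n : ℤ) ≡ digitSum g n [ZMOD (g : ℤ) - 1] := by
  have h : g % (g - 1) = 1 := by
    rw [Nat.mod_eq_sub_mod (by omega), Nat.mod_eq_of_lt (by omega)]; omega
  have := Int.natCast_modEq_iff.2 (Nat.modEq_digits_sum (g - 1) g h n)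
  rwa [Nat.cast_sub (by omega), Nat.cast_one] at this

lemma rS_mul_eq_integral {g : ℕ} (hg : 3 ≤ g) (K M : ℕ) (k₀ k₁ k₂ : ℤ)
    (hk : k₀ + k₁ + k₂ ≡ (M : ℤ) [ZMOD ((g : ℤ) - 1)]) :
    ((rS g K k₀ k₁ k₂ M * (2 * Real.pi) ^ 3 : ℝ) : ℂ) =
      ∫ x in Metric.closedBall (0 : Fin 3 → ℝ) Real.pi,
        expI (-(phaseOf g x 0 * k₀ + phaseOf g x 1 * k₁ + phaseOf g x 2 * k₂)) *
          transferOp g (phaseOf g x) K indicatorZero M := by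
  have hint (f : (Fin 3 → ℝ) → ℂ) (hf : Continuous f) :
      MeasureTheory.IntegrableOn f (Metric.closedBall 0 Real.pi) :=
    hf.continuousOn.integrableOn_compact (isCompact_closedBall _ _)
  have hph (i : Fin 3) : Continuous fun x => phaseOf g x i :=
    (continuous_apply i).comp (continuous_phaseOf g)
  have h0 := hph 0
  have h1 := hph 1
  have h2 := hph 2
  have hcont (a b : ℕ) : Continuous fun x => expI (-(phaseOf g x 0 * k₀ + phaseOf g x 1 * k₁ +
      phaseOf g x 2 * k₂)) * (expI (phaseOf g x 0 * digitSum g a + phaseOf g x 1 * digitSum g b +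
        phaseOf g x 2 * residueDigitSum g K (M - a - b)) *
      indicatorZero ((M - a - b) / (g : ℤ) ^ K)) := by
    refine (continuous_expI.comp ?_).mul ((continuous_expI.comp ?_).mul continuous_const) <;>
      fun_prop
  simp only [transferOp, Finset.mul_sum]
  rw [MeasureTheory.integral_finsetSum _ fun a _ => hint _ (continuous_finsetSum _ fun b _ => hcont a b)]
  simp only [MeasureTheory.integral_finsetSum _ fun b _ => hint _ (hcont _ b)]
  have key : ∀ a ∈ Finset.range (g ^ K), ∀ b ∈ Finset.range (g ^ K),
      (∫ x in Metric.closedBall (0 : Fin 3 → ℝ) Real.pi, expI (-(phaseOf g x 0 * k₀ +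
        phaseOf g x 1 * k₁ + phaseOf g x 2 * k₂)) *
        (expI (phaseOf g x 0 * digitSum g a + phaseOf g x 1 * digitSum g b +
          phaseOf g x 2 * residueDigitSum g K (M - a - b)) *
        indicatorZero ((M - a - b) / (g : ℤ) ^ K))) =
      if (a + b ≤ M ∧ M - a - b < g ^ K ∧ (digitSum g a : ℤ) = k₀ ∧ (digitSum g b : ℤ) = k₁ ∧
        (digitSum g (M - a - b) : ℤ) = k₂) then (((2 * Real.pi) ^ 3 : ℝ) : ℂ) else 0 := by
    intro a _ b _
    have hG : (0 : ℤ) < (g : ℤ) ^ K := by positivity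
    by_cases hc : a + b ≤ M ∧ M - a - b < g ^ K
    · have hz : (M : ℤ) - a - b = ((M - a - b : ℕ) : ℤ) := by omega
      have hlt : ((M - a - b : ℕ) : ℤ) < (g : ℤ) ^ K := by exact_mod_cast hc.2
      rw [hz, Int.ediv_eq_zero_of_lt (by positivity) hlt, residueDigitSum,
        Int.emod_eq_of_lt (by positivity) hlt, Int.toNat_natCast]
      simp only [indicatorZero, if_true, mul_one, ← expI_add]
      have := integral_closedBall_expI_phaseOf (by omega : 2 ≤ g)
        ![(digitSum g a : ℤ) - k₀, (digitSum g b : ℤ) - k₁, (digitSum g (M - a - b) : ℤ) - k₂] ?_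
      · convert this using 2
        · ext x
          congr 1
          simp only [Matrix.cons_val]
          push_cast
          ring
        · simp [funext_iff, Fin.forall_fin_succ, hc, sub_eq_zero]
      · simp only [Matrix.cons_val]
        have ha := modEq_digitSum hg a
        have hb := modEq_digitSum hg b
        have hr := modEq_digitSum hg (M - a - b)
        have hM : k₀ + k₁ + k₂ ≡ digitSum g a + digitSum g b + digitSum g (M - a - b)
            [ZMOD (g : ℤ) - 1] := by
          refine hk.trans ?_
          rw [show (M : ℤ) = a + b + (M - a - b : ℕ) by omega]
          exact (ha.add hb).add hr
        convert hM.dvd using 1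
        ring
    · have : ((M : ℤ) - a - b) / (g : ℤ) ^ K ≠ 0 := by
        intro h
        have hdiv := Int.emod_add_mul_ediv ((M : ℤ) - a - b) ((g : ℤ) ^ K)
        rw [h, mul_zero, add_zero] at hdiv
        have hnn := Int.emod_nonneg ((M : ℤ) - a - b) hG.ne'
        have hlt := Int.emod_lt_of_pos ((M : ℤ) - a - b) hG
        rw [hdiv] at hnn hlt
        refine hc ⟨by omega, ?_⟩
        zify
        rw [Int.natCast_sub (by omega), Int.natCast_sub (by omega)]
        exact hlt
      rw [if_neg (by tauto)]
      simp [indicatorZero, this]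
  rw [Finset.sum_congr rfl fun a ha => Finset.sum_congr rfl fun b hb => key a ha b hb,
    ← Finset.sum_product', ← Finset.sum_filter, Finset.sum_const, nsmul_eq_mul]
  push_cast
  congr 2
  unfold rS
  refine Finset.card_nbij' (fun p => (p.1, p.2.1)) (fun p => (p.1, p.2, M - p.1 - p.2)) ?_ ?_ ?_ ?_
  · rintro ⟨a, b, c⟩ h
    simp only [Sset, Finset.coe_filter, Finset.mem_product, Finset.mem_filter, Finset.mem_range,
      Set.mem_ofPred_eq] at h ⊢
    have : M - a - b = c := by omega
    rw [this]
    exact ⟨⟨h.1.1.1, h.1.2.1.1⟩, by omega, h.1.2.2.1, h.1.1.2, h.1.2.1.2, h.1.2.2.2⟩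
  · rintro ⟨a, b⟩ h
    simp only [Sset, Finset.coe_filter, Finset.mem_product, Finset.mem_filter, Finset.mem_range,
      Set.mem_ofPred_eq] at h ⊢
    exact ⟨⟨⟨h.1.1, h.2.2.2.1⟩, ⟨h.1.2, h.2.2.2.2.1⟩, h.2.2.1, h.2.2.2.2.2⟩, by omega⟩
  · rintro ⟨a, b, c⟩ h
    simp only [Sset, Finset.coe_filter, Finset.mem_product, Finset.mem_filter, Finset.mem_range,
      Set.mem_ofPred_eq] at h ⊢
    simp only [Prod.mk.injEq, true_and]
    omega
  · rintro ⟨a, b⟩ h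
    rfl

lemma setIntegral_compl_exp_neg_sqLen_phaseOf_le {g : ℕ} (hg : 2 ≤ g) {b δ : ℝ} (hb : 0 < b)
    (hδ : 0 ≤ δ) :
    |∫ x in (Metric.closedBall (0 : Fin 3 → ℝ) δ)ᶜ, Real.exp (-(b * sqLen (phaseOf g x)))| ≤
      Real.exp (-(b * δ ^ 2 / (2 * (g : ℝ) ^ 2))) * ((g - 1) * √(Real.pi / (b / 2)) ^ 3) := by
  have hg0 : (0 : ℝ) < (g : ℝ) ^ 2 := by positivity
  have hi := integrable_exp_neg_sqLen_phaseOf hg (half_pos hb)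
  rw [abs_of_nonneg (MeasureTheory.integral_nonneg fun x => (Real.exp_pos _).le),
    ← integral_exp_neg_sqLen_phaseOf hg, ← MeasureTheory.integral_const_mul]
  refine (MeasureTheory.setIntegral_mono_on
    (integrable_exp_neg_sqLen_phaseOf hg hb).integrableOn (hi.const_mul _).integrableOn
    Metric.isClosed_closedBall.measurableSet.compl fun x hx => ?_).trans
    (MeasureTheory.setIntegral_le_integral (hi.const_mul _)
      (Filter.Eventually.of_forall fun x => by positivity))
  rw [← Real.exp_add, Real.exp_le_exp]
  have hx' : δ ≤ ‖x‖ := by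
    simpa using (not_le.1 (by simpa using hx : ¬ ‖x‖ ≤ δ)).le
  have h1 := norm_sq_le_sqLen_phaseOf hg x
  have h2 : δ ^ 2 / (g : ℝ) ^ 2 ≤ sqLen (phaseOf g x) := by
    rw [div_le_iff₀ hg0]
    nlinarith [pow_le_pow_left₀ hδ hx' 2]
  have h3 := mul_le_mul_of_nonneg_left h2 (half_pos hb).le
  have h4 : b * δ ^ 2 / (2 * (g : ℝ) ^ 2) = b / 2 * (δ ^ 2 / (g : ℝ) ^ 2) := by
    field_simp
  rw [h4]
  linarith

lemma measureReal_closedBall {δ : ℝ} (hδ : 0 ≤ δ) :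
    MeasureTheory.volume.real (Metric.closedBall (0 : Fin 3 → ℝ) δ) = (2 * δ) ^ 3 := by
  rw [MeasureTheory.measureReal_def, Real.volume_pi_closedBall _ hδ,
    ENNReal.toReal_ofReal (by positivity), Fintype.card_fin]

lemma abs_rS_mul_sub_le {g : ℕ} (hg : 3 ≤ g) (j h M : ℕ) (hj : 0 < j) (hM : M ≤ g ^ (j + h))
    {k₀ k₁ k₂ : ℤ} {C δ : ℝ} (hC : 0 ≤ C) (hδ : 0 ≤ δ) (hgδ : 6 * g * δ ≤ 1)
    (h₀ : |(k₀ : ℝ) - muK g (j + h)| ≤ C) (h₁ : |(k₁ : ℝ) - muK g (j + h)| ≤ C)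
    (h₂ : |(k₂ : ℝ) - muK g (j + h)| ≤ C)
    (hk : k₀ + k₁ + k₂ ≡ (M : ℤ) [ZMOD ((g : ℤ) - 1)]) {b : ℝ}
    (hb : b = ((g : ℝ) ^ 2 - 1) / 24 * ((j + h : ℕ) : ℝ)) :
    |rS g (j + h) k₀ k₁ k₂ M * (2 * Real.pi) ^ 3 -
        (M : ℝ) ^ 2 / 2 * ((g - 1) * √(Real.pi / b) ^ 3)| ≤
      3 * (g : ℝ) ^ (2 * (j + h)) *
          Real.exp (-(((j + h : ℕ) : ℝ) * δ ^ 2 / (20 * (g : ℝ) ^ 4))) * (2 * Real.pi) ^ 3 +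
        (g : ℝ) ^ (2 * (j + h)) * (5 * ((g : ℝ) ^ h)⁻¹ +
          (3 * C + 7 * (g : ℝ) ^ 2) * ((h + 1) * (2 * δ)) +
          28 * (g : ℝ) ^ 3 * (((j + h : ℕ) : ℝ) * (2 * δ) ^ 3)) * (2 * δ) ^ 3 +
        (M : ℝ) ^ 2 / 2 * (Real.exp (-(b * δ ^ 2 / (2 * (g : ℝ) ^ 2))) *
          ((g - 1) * √(Real.pi / (b / 2)) ^ 3)) := by
  have hg2 : 2 ≤ g := by omega
  have hg3 : (3 : ℝ) ≤ g := by exact_mod_cast hg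
  set K := j + h with hK
  have hb0 : 0 < b := by
    have : (0 : ℝ) < (K : ℝ) := by exact_mod_cast (by omega : 0 < K)
    have : (0 : ℝ) < (g : ℝ) ^ 2 - 1 := by nlinarith
    rw [hb]; positivity
  have hδπ : δ ≤ Real.pi := by nlinarith [Real.pi_gt_three]
  set I : (Fin 3 → ℝ) → ℂ := fun x =>
    expI (-(phaseOf g x 0 * k₀ + phaseOf g x 1 * k₁ + phaseOf g x 2 * k₂)) *
      transferOp g (phaseOf g x) K indicatorZero M with hI
  set E : (Fin 3 → ℝ) → ℝ := fun x =>
    (M : ℝ) ^ 2 / 2 * Real.exp (-(b * sqLen (phaseOf g x))) with hE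
  have hIc : Continuous I := by
    have hph (i : Fin 3) : Continuous fun x => phaseOf g x i :=
      (continuous_apply i).comp (continuous_phaseOf g)
    have h0 := hph 0
    have h1 := hph 1
    have h2 := hph 2
    exact (continuous_expI.comp (by fun_prop)).mul
      ((continuous_transferOp g K _ _).comp (continuous_phaseOf g))
  have hIi (r : ℝ) : MeasureTheory.IntegrableOn I (Metric.closedBall 0 r) :=
    hIc.continuousOn.integrableOn_compact (isCompact_closedBall _ _)
  have hEi : MeasureTheory.Integrable E :=
    (integrable_exp_neg_sqLen_phaseOf hg2 hb0).const_mul _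
  have hms : MeasurableSet (Metric.closedBall (0 : Fin 3 → ℝ) δ) :=
    Metric.isClosed_closedBall.measurableSet
  have hsub : Metric.closedBall (0 : Fin 3 → ℝ) δ ⊆ Metric.closedBall 0 Real.pi :=
    Metric.closedBall_subset_closedBall hδπ
  have hEint : ∫ x, E x = (M : ℝ) ^ 2 / 2 * ((g - 1) * √(Real.pi / b) ^ 3) := by
    rw [MeasureTheory.integral_const_mul, integral_exp_neg_sqLen_phaseOf hg2]
  have hsplit : ((rS g K k₀ k₁ k₂ M * (2 * Real.pi) ^ 3 -
        (M : ℝ) ^ 2 / 2 * ((g - 1) * √(Real.pi / b) ^ 3) : ℝ) : ℂ) =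
      (∫ x in Metric.closedBall 0 Real.pi \ Metric.closedBall 0 δ, I x) +
        (∫ x in Metric.closedBall 0 δ, (I x - (E x : ℂ))) -
        ((∫ x in (Metric.closedBall 0 δ)ᶜ, E x : ℝ) : ℂ) := by
    have hdiff : ∫ x in Metric.closedBall 0 δ, (I x - (E x : ℂ)) =
        (∫ x in Metric.closedBall 0 δ, I x) - ((∫ x in Metric.closedBall 0 δ, E x : ℝ) : ℂ) := by
      rw [← integral_complex_ofReal]
      exact MeasureTheory.integral_sub (hIi δ) hEi.ofReal.integrableOn
    rw [Complex.ofReal_sub, rS_mul_eq_integral hg K M k₀ k₁ k₂ hk, ← hEint, hdiff,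
      ← MeasureTheory.integral_add_compl hms hEi,
      MeasureTheory.setIntegral_sdiff hms (hIi Real.pi) hsub]
    push_cast
    ring
  rw [← Real.norm_eq_abs, ← Complex.norm_real, hsplit]
  refine (norm_sub_le _ _).trans (add_le_add ((norm_add_le _ _).trans (add_le_add ?_ ?_)) ?_)
  · refine (MeasureTheory.norm_setIntegral_le_of_norm_le_const
      ((MeasureTheory.measure_mono Set.sdiff_subset).trans_lt
        (isCompact_closedBall _ _).measure_lt_top) fun x hx => ?_).trans
      (mul_le_mul_of_nonneg_left ((MeasureTheory.measureReal_mono Set.sdiff_subset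
        (isCompact_closedBall _ _).measure_lt_top.ne).trans_eq
        (measureReal_closedBall Real.pi_pos.le)) (by positivity))
    have hxπ : ‖x‖ ≤ Real.pi := by simpa using hx.1
    have hxδ : δ ≤ ‖x‖ := (not_le.1 (by simpa using hx.2 : ¬ ‖x‖ ≤ δ)).le
    rw [hI, norm_mul, norm_expI, one_mul]
    refine (norm_transferOp_le_exp hg2 x hxπ indicatorZero zero_le_one norm_indicatorZero_le K M).trans ?_
    rw [mul_one]
    gcongr
  · refine (MeasureTheory.norm_setIntegral_le_of_norm_le_const
      (isCompact_closedBall _ _).measure_lt_top fun x hx => ?_).trans_eq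
      (congrArg _ (measureReal_closedBall hδ))
    have hxδ : ‖x‖ ≤ δ := by simpa using hx
    have hp : ‖phaseOf g x‖ ≤ 2 * δ := (norm_phaseOf_le hg2 x).trans (by linarith)
    have hp1 : 3 * (g * ‖phaseOf g x‖) ≤ 1 := by nlinarith
    have := norm_phase_sub_gaussian_le hg2 (phaseOf g x) hp1 j h M hM hC h₀ h₁ h₂
    rw [← hK, ← hb] at this
    refine this.trans ?_
    gcongr
  · rw [Complex.norm_real, MeasureTheory.integral_const_mul, norm_mul, Real.norm_eq_abs,
      Real.norm_eq_abs, abs_of_nonneg (by positivity : (0 : ℝ) ≤ (M : ℝ) ^ 2 / 2)]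
    exact mul_le_mul_of_nonneg_left (setIntegral_compl_exp_neg_sqLen_phaseOf_le hg2 hb0 hδ)
      (by positivity)

/-- The implied constant in `error_terms_le`. -/
def errorConst (g : ℕ) (C : ℝ) : ℝ :=
  3 * (g : ℝ) ^ 2 * (2 * Real.pi) ^ 3 +
    8 * (g : ℝ) ^ 2 * (5 + 6 * (3 * C + 7 * (g : ℝ) ^ 2) + 224 * (g : ℝ) ^ 3) +
    (g - 1) * √(48 * Real.pi) ^ 3

lemma exp_neg_mul_sq_le {a L Q : ℝ} (hQ : 0 < Q) (hL : 0 ≤ L) (hLQ : L = 4 * Real.log Q)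
    (haL : 7 ≤ 4 * (a * L)) : Real.exp (-(a * L ^ 2)) ≤ (Q ^ 7)⁻¹ := by
  have : (Q ^ 7)⁻¹ = Real.exp (-(7 * Real.log Q)) := by
    rw [Real.exp_neg, mul_comm, Real.exp_mul, Real.exp_log hQ]
    norm_cast
  rw [this, Real.exp_le_exp]
  nlinarith

lemma gaussian_error_factor_le {g K h : ℕ} {C L Q δ : ℝ} (hC : 0 ≤ C) (hQ : 1 ≤ Q)
    (hKQ : (K : ℝ) = Q ^ 4) (hL1 : 1 ≤ L) (hδ : δ = L / Q ^ 2)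
    (hh : ((g : ℝ) ^ h)⁻¹ ≤ (Q ^ 4)⁻¹) (hhL : (h : ℝ) + 1 ≤ 3 * L) :
    5 * ((g : ℝ) ^ h)⁻¹ + (3 * C + 7 * (g : ℝ) ^ 2) * ((h + 1) * (2 * δ)) +
      28 * (g : ℝ) ^ 3 * (K * (2 * δ) ^ 3) ≤
      (5 + 6 * (3 * C + 7 * (g : ℝ) ^ 2) + 224 * (g : ℝ) ^ 3) * (L ^ 3 * (Q ^ 2)⁻¹) := by
  have hQ0 : 0 < Q := by linarith
  have hL0 : 0 ≤ L := by linarith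
  have hδ0 : 0 ≤ δ := by rw [hδ]; positivity
  have hQ24 : (Q ^ 4)⁻¹ ≤ (Q ^ 2)⁻¹ :=
    inv_anti₀ (by positivity) (pow_le_pow_right₀ hQ (by norm_num))
  have hL3 : 1 ≤ L ^ 3 := one_le_pow₀ hL1
  have hL23 : L ^ 2 ≤ L ^ 3 := pow_le_pow_right₀ hL1 (by norm_num)
  have hQ2 : 0 < (Q ^ 2)⁻¹ := by positivity
  have t1 : ((g : ℝ) ^ h)⁻¹ ≤ L ^ 3 * (Q ^ 2)⁻¹ :=
    (hh.trans hQ24).trans (le_mul_of_one_le_left hQ2.le hL3)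
  have t2 : ((h : ℝ) + 1) * (2 * δ) ≤ 6 * (L ^ 3 * (Q ^ 2)⁻¹) := by
    calc ((h : ℝ) + 1) * (2 * δ) ≤ 3 * L * (2 * δ) := by gcongr
      _ = 6 * (L ^ 2 * (Q ^ 2)⁻¹) := by rw [hδ]; ring
      _ ≤ _ := by gcongr
  have t3 : (K : ℝ) * (2 * δ) ^ 3 = 8 * (L ^ 3 * (Q ^ 2)⁻¹) := by
    rw [hKQ, hδ]; field_simp; ring
  rw [t3]
  have t4 := mul_le_mul_of_nonneg_left t2 (by positivity : 0 ≤ 3 * C + 7 * (g : ℝ) ^ 2)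
  linarith

lemma pow_mul_cutoff_pow_le {L Q δ : ℝ} (hQ : 0 < Q) (hL2 : L ^ 2 ≤ Q)
    (hδ : δ = L / Q ^ 2) : L ^ 3 * (Q ^ 2)⁻¹ * (2 * δ) ^ 3 ≤ 8 * (L ^ 4 * (Q ^ 7)⁻¹) := by
  have : L ^ 3 * (Q ^ 2)⁻¹ * (2 * δ) ^ 3 = 8 * (L ^ 4 * (Q ^ 8)⁻¹) * L ^ 2 := by
    rw [hδ]; field_simp; ring
  rw [this]
  calc 8 * (L ^ 4 * (Q ^ 8)⁻¹) * L ^ 2 ≤ 8 * (L ^ 4 * (Q ^ 8)⁻¹) * Q := by gcongr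
    _ = _ := by field_simp

/-- With `K = Q ^ 4`, `L = log K` and the cutoff `δ = L / Q ^ 2`, the error terms of
`abs_rS_mul_sub_le` are `O(M ^ 2 L ^ 4 / Q ^ 7)`. -/
lemma error_terms_le {g : ℕ} (hg : 3 ≤ g) {K h : ℕ} {M C L Q δ b : ℝ} (hC : 0 ≤ C) (hQ : 1 ≤ Q)
    (hKQ : (K : ℝ) = Q ^ 4) (hLQ : L = 4 * Real.log Q) (hgL : 35 * (g : ℝ) ^ 4 ≤ L)
    (hL2 : L ^ 2 ≤ Q) (hδ : δ = L / Q ^ 2) (hb : b = ((g : ℝ) ^ 2 - 1) / 24 * K)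
    (hM : (g : ℝ) ^ (2 * K) ≤ (g : ℝ) ^ 2 * M ^ 2)
    (hh : ((g : ℝ) ^ h)⁻¹ ≤ (Q ^ 4)⁻¹) (hhL : (h : ℝ) + 1 ≤ 3 * L) :
    3 * (g : ℝ) ^ (2 * K) * Real.exp (-(K * δ ^ 2 / (20 * (g : ℝ) ^ 4))) * (2 * Real.pi) ^ 3 +
        (g : ℝ) ^ (2 * K) * (5 * ((g : ℝ) ^ h)⁻¹ +
          (3 * C + 7 * (g : ℝ) ^ 2) * ((h + 1) * (2 * δ)) +
          28 * (g : ℝ) ^ 3 * (K * (2 * δ) ^ 3)) * (2 * δ) ^ 3 +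
        M ^ 2 / 2 * (Real.exp (-(b * δ ^ 2 / (2 * (g : ℝ) ^ 2))) *
          ((g - 1) * √(Real.pi / (b / 2)) ^ 3)) ≤
      errorConst g C * M ^ 2 * L ^ 4 / Q ^ 7 := by
  have hg3 : (3 : ℝ) ≤ g := by exact_mod_cast hg
  have hQ0 : 0 < Q := by linarith
  have hg4 : (81 : ℝ) ≤ (g : ℝ) ^ 4 := by
    have := pow_le_pow_left₀ (by norm_num) hg3 4
    norm_num at this ⊢
    exact this
  have hL1 : 1 ≤ L := by linarith
  have hL0 : 0 ≤ L := by linarith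
  have hL4 : 1 ≤ L ^ 4 := one_le_pow₀ hL1
  have hδ0 : 0 ≤ δ := by rw [hδ]; positivity
  have hKδ : (K : ℝ) * δ ^ 2 = L ^ 2 := by rw [hKQ, hδ]; field_simp
  have hM2 : 0 ≤ M ^ 2 := sq_nonneg M
  have hQ7 : 0 < (Q ^ 7)⁻¹ := by positivity
  have e1 : Real.exp (-(K * δ ^ 2 / (20 * (g : ℝ) ^ 4))) ≤ L ^ 4 * (Q ^ 7)⁻¹ := by
    rw [hKδ, div_eq_inv_mul]
    refine (exp_neg_mul_sq_le hQ0 hL0 hLQ ?_).trans (le_mul_of_one_le_left hQ7.le hL4)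
    rw [inv_mul_eq_div, mul_div_assoc', le_div_iff₀ (by positivity)]
    linarith
  have e3 : Real.exp (-(b * δ ^ 2 / (2 * (g : ℝ) ^ 2))) ≤ L ^ 4 * (Q ^ 7)⁻¹ := by
    have : b * δ ^ 2 / (2 * (g : ℝ) ^ 2) = ((g : ℝ) ^ 2 - 1) / (48 * (g : ℝ) ^ 2) * L ^ 2 := by
      rw [hb, ← hKδ]; field_simp; ring
    rw [this]
    refine (exp_neg_mul_sq_le hQ0 hL0 hLQ ?_).trans (le_mul_of_one_le_left hQ7.le hL4)
    rw [div_mul_eq_mul_div, mul_div_assoc', le_div_iff₀ (by positivity)]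
    have h8 : 8 ≤ (g : ℝ) ^ 2 - 1 := by nlinarith
    have h9 : (g : ℝ) ^ 2 * 9 ≤ (g : ℝ) ^ 4 := by nlinarith
    nlinarith
  have e4 : √(Real.pi / (b / 2)) ≤ √(48 * Real.pi) := by
    apply Real.sqrt_le_sqrt
    have hK1 : 1 ≤ (K : ℝ) := by rw [hKQ]; exact one_le_pow₀ hQ
    have h8 : 1 ≤ (g : ℝ) ^ 2 - 1 := by nlinarith
    have hb1 : 1 / 24 ≤ b := by rw [hb]; nlinarith
    rw [div_le_iff₀ (by linarith)]
    nlinarith [Real.pi_pos]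
  have e5 := gaussian_error_factor_le hC hQ hKQ hL1 hδ hh hhL
  have e6 := pow_mul_cutoff_pow_le hQ0 hL2 hδ
  set W := L ^ 4 * (Q ^ 7)⁻¹ with hW
  have hW0 : 0 ≤ W := by positivity
  have hg1 : (0 : ℝ) ≤ g - 1 := by linarith
  set D := 5 + 6 * (3 * C + 7 * (g : ℝ) ^ 2) + 224 * (g : ℝ) ^ 3 with hD
  have hD0 : 0 ≤ D := by positivity
  calc _ ≤ 3 * ((g : ℝ) ^ 2 * M ^ 2) * W * (2 * Real.pi) ^ 3 +
        ((g : ℝ) ^ 2 * M ^ 2) * (D * (L ^ 3 * (Q ^ 2)⁻¹)) * (2 * δ) ^ 3 +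
        M ^ 2 / 2 * (W * ((g - 1) * √(48 * Real.pi) ^ 3)) := by
        have := Real.pi_pos
        gcongr
    _ = 3 * ((g : ℝ) ^ 2 * M ^ 2) * W * (2 * Real.pi) ^ 3 +
        ((g : ℝ) ^ 2 * M ^ 2) * D * (L ^ 3 * (Q ^ 2)⁻¹ * (2 * δ) ^ 3) +
        M ^ 2 / 2 * (W * ((g - 1) * √(48 * Real.pi) ^ 3)) := by ring
    _ ≤ 3 * ((g : ℝ) ^ 2 * M ^ 2) * W * (2 * Real.pi) ^ 3 +
        ((g : ℝ) ^ 2 * M ^ 2) * D * (8 * W) +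
        M ^ 2 * (W * ((g - 1) * √(48 * Real.pi) ^ 3)) := by
        gcongr
        linarith
    _ = errorConst g C * M ^ 2 * W := by rw [errorConst, ← hD]; ring
    _ = _ := by rw [hW]; ring

lemma rpow_three_halves {x : ℝ} (hx : 0 ≤ x) : x ^ ((3 : ℝ) / 2) = √x ^ 3 := by
  rw [Real.sqrt_eq_rpow, ← Real.rpow_natCast, ← Real.rpow_mul hx]
  norm_num

lemma sqrt_pi_div_eq {v K Q b : ℝ} (hv : 0 < v) (hQ : 0 < Q) (hK : K = Q ^ 4)
    (hb : b = v / 2 * K) : √(Real.pi / b) = 2 * Real.pi / (√(2 * Real.pi * v) * Q ^ 2) := by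
  have hπ := Real.pi_pos
  rw [Real.sqrt_eq_iff_eq_sq (by rw [hb, hK]; positivity) (by positivity), div_pow,
    mul_pow √_, Real.sq_sqrt (by positivity), hb, hK]
  field_simp

lemma eventually_log_bounds (B : ℝ) :
    ∃ N : ℕ, ∀ K : ℕ, N ≤ K → B ≤ Real.log K ∧ Real.log K ^ 2 ≤ (K : ℝ) ^ ((1 : ℝ) / 4) := by
  have h1 : ∀ᶠ x : ℝ in Filter.atTop, B ≤ Real.log x := Real.tendsto_log_atTop.eventually_ge_atTop B
  have h2 : ∀ᶠ x : ℝ in Filter.atTop, Real.log x ^ 2 ≤ x ^ ((1 : ℝ) / 4) := by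
    have := (isLittleO_log_rpow_rpow_atTop 2 (by norm_num : (0 : ℝ) < 1 / 4)).bound one_pos
    filter_upwards [this, Filter.eventually_ge_atTop 0] with x hx hx0
    rw [one_mul, Real.norm_of_nonneg (Real.rpow_nonneg hx0 _), Real.rpow_two,
      Real.norm_of_nonneg (sq_nonneg _)] at hx
    exact hx
  obtain ⟨N, hN⟩ := Filter.eventually_atTop.1 (tendsto_natCast_atTop_atTop.eventually (h1.and h2))
  exact ⟨N, hN⟩

lemma pow_two_mul_le {g K M : ℕ} (hK : 0 < K) (hM : g ^ (K - 1) < M) :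
    (g : ℝ) ^ (2 * K) ≤ (g : ℝ) ^ 2 * (M : ℝ) ^ 2 := by
  obtain ⟨n, rfl⟩ : ∃ n, K = n + 1 := ⟨K - 1, by omega⟩
  have h : (g : ℝ) ^ n ≤ M := by exact_mod_cast hM.le
  calc (g : ℝ) ^ (2 * (n + 1)) = (g : ℝ) ^ 2 * ((g : ℝ) ^ n) ^ 2 := by ring
    _ ≤ _ := by gcongr

lemma inv_pow_ceil_log_le {g : ℕ} (hg : 3 ≤ g) {K : ℝ} (hK : 0 < K) :
    ((g : ℝ) ^ ⌈Real.log K⌉₊)⁻¹ ≤ K⁻¹ := by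
  refine inv_anti₀ hK ?_
  have hg3 : (3 : ℝ) ≤ g := by exact_mod_cast hg
  have he : Real.exp 1 ≤ g := by linarith [Real.exp_one_lt_d9]
  calc K = Real.exp (Real.log K) := (Real.exp_log hK).symm
    _ ≤ Real.exp (⌈Real.log K⌉₊ * 1) := Real.exp_le_exp.2 (by rw [mul_one]; exact Nat.le_ceil _)
    _ = Real.exp 1 ^ ⌈Real.log K⌉₊ := Real.exp_nat_mul _ _
    _ ≤ _ := by gcongr

theorem statement1 (g : ℕ) (hg : 3 ≤ g) :
    ∃ c : ℝ, 0 < c ∧ ∃ K0 : ℕ, ∀ K : ℕ, K0 ≤ K →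
      ∀ M : ℕ, g ^ (K - 1) < M → M ≤ g ^ K →
      ∀ k1 k2 k3 : ℤ,
        |(k1 : ℝ) - muK g K| ≤ Cg g →
        |(k2 : ℝ) - muK g K| ≤ Cg g →
        |(k3 : ℝ) - muK g K| ≤ Cg g →
        k1 + k2 + k3 ≡ (M : ℤ) [ZMOD ((g : ℤ) - 1)] →
        |(rS g K k1 k2 k3 M : ℝ) -
            ((g : ℝ) - 1) * (M : ℝ) ^ 2 /
              (2 * (2 * Real.pi * (((g : ℝ) ^ 2 - 1) / 12) * K) ^ ((3 : ℝ) / 2))| ≤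
          c * (((g : ℝ) - 1) * (M : ℝ) ^ 2 /
              (2 * (2 * Real.pi * (((g : ℝ) ^ 2 - 1) / 12) * K) ^ ((3 : ℝ) / 2))) *
            Real.log K ^ 4 * (K : ℝ) ^ (-(1 : ℝ) / 4) := by
  have hg3 : (3 : ℝ) ≤ g := by exact_mod_cast hg
  have hπ := Real.pi_pos
  have hg1 : (0 : ℝ) < g - 1 := by linarith
  set v := ((g : ℝ) ^ 2 - 1) / 12 with hv
  have hv0 : 0 < v := by
    have : (0 : ℝ) < (g : ℝ) ^ 2 - 1 := by nlinarith
    positivity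
  set s := √(2 * Real.pi * v) with hs
  have hs0 : 0 < s := Real.sqrt_pos.2 (by positivity)
  have hC : (0 : ℝ) ≤ Cg g := Nat.cast_nonneg _
  have hE0 : 0 < errorConst g (Cg g) := by unfold errorConst; positivity
  obtain ⟨N, hN⟩ := eventually_log_bounds (35 * (g : ℝ) ^ 4)
  refine ⟨errorConst g (Cg g) * (2 * s ^ 3) / ((g - 1) * (2 * Real.pi) ^ 3), by positivity, N + 1,
    fun K hK M hM1 hM2 k₀ k₁ k₂ h₀ h₁ h₂ hk => ?_⟩
  obtain ⟨hgL, hL2⟩ := hN K (by omega)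
  set L := Real.log K with hL
  set Q := (K : ℝ) ^ ((1 : ℝ) / 4) with hQ
  have hK0 : (0 : ℝ) < K := by exact_mod_cast (by omega : 0 < K)
  have hL35 : 35 ≤ L := by
    have : (1 : ℝ) ≤ (g : ℝ) ^ 4 := one_le_pow₀ (by linarith)
    linarith
  have hQL : L + 1 < Q := by nlinarith
  have hQ1 : 1 ≤ Q := by linarith
  have hQ0 : 0 < Q := by linarith
  have hKQ : (K : ℝ) = Q ^ 4 := by
    rw [hQ, ← Real.rpow_natCast, ← Real.rpow_mul hK0.le]; norm_num
  have hLQ : L = 4 * Real.log Q := by rw [hL, hKQ, Real.log_pow]; norm_num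
  have hQK : Q ≤ K := hKQ ▸ le_self_pow₀ hQ1 (by norm_num)
  set h := ⌈L⌉₊ with hh
  have hhL : (h : ℝ) < L + 1 := Nat.ceil_lt_add_one (by linarith)
  have hhK : h < K := by
    have : (h : ℝ) < K := by linarith
    exact_mod_cast this
  have hKjh : K - h + h = K := by omega
  have hinv : (K : ℝ) ^ (-(1 : ℝ) / 4) = Q⁻¹ := by rw [hQ, ← Real.rpow_neg hK0.le]; norm_num
  have hb : ((g : ℝ) ^ 2 - 1) / 24 * K = v / 2 * K := by rw [hv]; ring
  have hsK : √(2 * Real.pi * v * K) = s * Q ^ 2 := by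
    rw [Real.sqrt_mul (by positivity), ← hs, hKQ, show Q ^ 4 = (Q ^ 2) ^ 2 by ring,
      Real.sqrt_sq (by positivity)]
  rw [rpow_three_halves (by positivity), hsK, hinv]
  have hgδ : 6 * g * (L / Q ^ 2) ≤ 1 := by
    have hgL' : 6 * (g : ℝ) ≤ L := by
      have : (g : ℝ) ≤ (g : ℝ) ^ 4 := le_self_pow₀ (by linarith) (by norm_num)
      linarith
    rw [mul_div_assoc', div_le_one (by positivity)]
    nlinarith
  have hmain := abs_rS_mul_sub_le hg (K - h) h M (by omega) (by rwa [hKjh]) hC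
    (δ := L / Q ^ 2) (by positivity) hgδ (by rwa [hKjh]) (by rwa [hKjh]) (by rwa [hKjh]) hk rfl
  rw [hKjh] at hmain
  have herr := hmain.trans (error_terms_le hg (M := M) hC hQ1 hKQ hLQ hgL hL2 rfl rfl
    (pow_two_mul_le (by omega) hM1) (hKQ ▸ inv_pow_ceil_log_le hg hK0) (by linarith))
  rw [sqrt_pi_div_eq hv0 hQ0 hKQ hb, ← hs] at herr
  have e1 : (rS g K k₀ k₁ k₂ M : ℝ) - (g - 1) * (M : ℝ) ^ 2 / (2 * (s * Q ^ 2) ^ 3) =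
      (rS g K k₀ k₁ k₂ M * (2 * Real.pi) ^ 3 -
        (M : ℝ) ^ 2 / 2 * ((g - 1) * (2 * Real.pi / (s * Q ^ 2)) ^ 3)) / (2 * Real.pi) ^ 3 := by
    field_simp
  have e2 : errorConst g (Cg g) * (2 * s ^ 3) / ((g - 1) * (2 * Real.pi) ^ 3) *
      ((g - 1) * (M : ℝ) ^ 2 / (2 * (s * Q ^ 2) ^ 3)) * L ^ 4 * Q⁻¹ =
      errorConst g (Cg g) * (M : ℝ) ^ 2 * L ^ 4 / Q ^ 7 / (2 * Real.pi) ^ 3 := by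
    field_simp
  rw [e1, e2, abs_div, abs_of_pos (by positivity : (0 : ℝ) < (2 * Real.pi) ^ 3)]
  gcongr
end
end
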